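/- arXiv:2404.06655 — 4 statements merged into one kernel-verified Lean document; each statement's English description precedes it below -/
import Mathlib

section
/- Let R be a semilocal Prüfer domain. Then R is the increasing (directed) union of a family of subrings each of which is a semilocal Prüfer domain of finite Krull dimension: there exists a directed family of subrings R_α ⊆ R with union equal to R, such that each R_α is an integral domain whose localisation at every prime is a valuation ring, each R_α has finitely many maximal ideals, and each R_α has finite Krull dimension. -/
/-- A valuation ring, per the context: an integral domain in which, for every pair of
elements, one divides the other. -/
def IsValuationDomain (V : Type*) [CommRing V] : Prop :=
  IsDomain V ∧ ∀ a b : V, a ∣ b ∨ b ∣ a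

/-- A Prüfer domain, per the context: an integral domain whose localisation at every
prime ideal is a valuation ring. -/
def IsPrueferDomain (R : Type*) [CommRing R] : Prop :=
  IsDomain R ∧ ∀ (p : Ideal R) [p.IsPrime], IsValuationDomain (Localization.AtPrime p)

/-- A semilocal ring: a ring having only finitely many maximal ideals. -/
def IsSemilocalRing (R : Type*) [CommRing R] : Prop :=
  {m : Ideal R | m.IsMaximal}.Finite

theorem poly_step {A : Type*} [CommRing A] (q0 q1 : Ideal A) [q0.IsPrime]
    (h01 : q0 ≤ q1) (x : A) (hx1 : x ∈ q1) (hx0 : x ∉ q0) (m : ℕ) :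
    ∀ p : Polynomial A, (∀ j < m, p.coeff j ∈ q0) → p.coeff m ∉ q1 → p.eval x ∉ q0 := by
  induction m with
  | zero =>
    intro p _ h2 h3
    rw [← Polynomial.divX_mul_X_add p] at h3
    simp only [Polynomial.eval_add, Polynomial.eval_mul, Polynomial.eval_X,
      Polynomial.eval_C] at h3
    exact h2 ((Ideal.add_mem_iff_right _ (q1.mul_mem_left _ hx1)).1 (h01 h3))
  | succ m ih =>
    intro p h1 h2 h3
    rw [← Polynomial.divX_mul_X_add p] at h3
    simp only [Polynomial.eval_add, Polynomial.eval_mul, Polynomial.eval_X,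
      Polynomial.eval_C] at h3
    have h4 := (Ideal.add_mem_iff_left _ (h1 0 (Nat.succ_pos _))).1 h3
    rcases (inferInstance : q0.IsPrime).mem_or_mem h4 with h5 | h5
    · refine ih p.divX (fun j hj => ?_) ?_ h5
      · rw [Polynomial.coeff_divX]; exact h1 _ (by omega)
      · rw [Polynomial.coeff_divX]; exact h2
    · exact hx0 h5

theorem chain_lemma {A : Type*} [CommRing A] (n : ℕ) :
    ∀ (q : Fin (n+1) → Ideal A) (_ : ∀ i, (q i).IsPrime) (_ : Monotone q)
      (x : Fin n → A) (_ : ∀ i, x i ∈ q i.succ) (_ : ∀ i, x i ∉ q i.castSucc)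
      (f : MvPolynomial (Fin n) A)
      (_ : ∀ m, f.coeff m ∈ q 0 ∨ f.coeff m ∉ q (Fin.last n))
      (_ : ∃ m, f.coeff m ∉ q (Fin.last n)), MvPolynomial.eval x f ∉ q 0 := by
  induction n with
  | zero =>
    intro q hq hm x _ _ f _ ⟨m, h2⟩ h3
    rw [MvPolynomial.eq_C_of_isEmpty f, MvPolynomial.eval_C] at h3
    rw [Subsingleton.elim m 0] at h2
    exact h2 h3
  | succ n ih =>
    intro q hq hm x hx1 hx0 f h1 h2
    have key : ∀ j, (∀ m, ((MvPolynomial.finSuccEquiv A n f).coeff j).coeff m ∈ q 0) ∨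
        MvPolynomial.eval (Fin.tail x) ((MvPolynomial.finSuccEquiv A n f).coeff j) ∉ q 1 := by
      intro j
      by_cases h : ∀ m, ((MvPolynomial.finSuccEquiv A n f).coeff j).coeff m ∈ q 0
      · exact Or.inl h
      · right
        push Not at h
        obtain ⟨m, hm'⟩ := h
        refine ih (Fin.tail q) (fun i => hq _) (fun i j hij => hm (Fin.succ_le_succ_iff.2 hij))
          (Fin.tail x) (fun i => hx1 i.succ) (fun i => hx0 i.succ) _ (fun m => ?_) ⟨m, ?_⟩
        · rw [MvPolynomial.finSuccEquiv_coeff_coeff]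
          exact (h1 _).imp_left (fun h => hm (Fin.zero_le _) h)
        · rw [MvPolynomial.finSuccEquiv_coeff_coeff] at hm' ⊢
          exact (h1 _).resolve_left hm'
    have hex : ∃ j, MvPolynomial.eval (Fin.tail x)
        ((MvPolynomial.finSuccEquiv A n f).coeff j) ∉ q 1 := by
      obtain ⟨m, hm'⟩ := h2
      refine ⟨m 0, (key (m 0)).resolve_left (fun h => ?_)⟩
      have := h m.tail
      rw [MvPolynomial.finSuccEquiv_coeff_coeff, Finsupp.cons_tail] at this
      exact hm' (hm (Fin.zero_le _) this)
    classical
    rw [← Fin.cons_self_tail x, MvPolynomial.eval_eq_eval_mv_eval']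
    have := hq 0
    refine poly_step (q 0) (q 1) (hm (Fin.zero_le _)) (x 0) (hx1 0) (hx0 0) (Nat.find hex) _ ?_ ?_
    · intro j hj
      have hk := (key j).resolve_right (Nat.find_min hex hj)
      rw [Polynomial.coeff_map, MvPolynomial.eval_eq]
      exact Ideal.sum_mem _ fun d _ => Ideal.mul_mem_right _ _ (hk d)
    · rw [Polynomial.coeff_map]
      exact Nat.find_spec hex

theorem exists_relation {A : Type*} [CommRing A] [IsDomain A] (S : Finset A)
    (hS : ∀ a : A, ∃ y ∈ Subring.closure (S : Set A), ∃ z ∈ Subring.closure (S : Set A),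
      z ≠ 0 ∧ z * a = y) (x : Fin (S.card + 1) → A) (q : Ideal A) [hq : q.IsPrime] :
    ∃ f : MvPolynomial (Fin (S.card + 1)) ℤ, MvPolynomial.aeval x f = 0 ∧
      ∃ m, ((f.coeff m : ℤ) : A) ∉ q := by
  let k := (Int.castRingHom A).range
  have hle : ∀ y ∈ Subring.closure (S : Set A), y ∈ Algebra.adjoin k (S : Set A) := by
    intro y hy
    have : Subring.closure (S : Set A) ≤ (Algebra.adjoin k (S : Set A)).toSubring :=
      Subring.closure_le.2 Algebra.subset_adjoin
    exact this hy
  have halg : Algebra.IsAlgebraic (Algebra.adjoin k (S : Set A)) A := by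
    constructor
    intro a
    obtain ⟨y, hy, z, hz, hz0, h⟩ := hS a
    refine ⟨Polynomial.C ⟨z, hle z hz⟩ * Polynomial.X - Polynomial.C ⟨y, hle y hy⟩, ?_, ?_⟩
    · intro h0
      have := congrArg (fun p => Polynomial.coeff p 1) h0
      simp [Polynomial.coeff_C] at this
      exact hz0 (congrArg Subtype.val this)
    · simp only [map_sub, map_mul, Polynomial.aeval_C, Polynomial.aeval_X]
      exact sub_eq_zero.2 h
  have hnot : ¬ AlgebraicIndependent k x := by
    intro hx
    have h1 := hx.lift_cardinalMk_le_trdeg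
    have h2 := Algebra.IsAlgebraic.trdeg_le_cardinalMk (R := k) (A := A) (s := (S : Set A))
    simp at h1 h2
    have h4 := h1.trans_le h2
    exact lt_irrefl _ h4
  have : ∃ f : MvPolynomial (Fin (S.card + 1)) ℤ, MvPolynomial.aeval x f = 0 ∧
      ∃ m, ((f.coeff m : ℤ) : A) ≠ 0 := by
    rw [algebraicIndependent_iff] at hnot
    push Not at hnot
    obtain ⟨f0, hf0, hf0'⟩ := hnot
    obtain ⟨f, rfl⟩ := MvPolynomial.map_surjective (Int.castRingHom A).rangeRestrict
      (Int.castRingHom A).rangeRestrict_surjective f0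
    refine ⟨f, ?_, ?_⟩
    · rw [← hf0, MvPolynomial.aeval_def, MvPolynomial.aeval_def, MvPolynomial.eval₂_map]
      congr 1
    · obtain ⟨m, hm⟩ := MvPolynomial.ne_zero_iff.1 hf0'
      refine ⟨m, fun h => hm ?_⟩
      rw [MvPolynomial.coeff_map]
      exact Subtype.ext h
  obtain ⟨f, hf, m, hm⟩ := this
  obtain ⟨p, hp⟩ := (IsPrincipalIdealRing.principal (q.comap (Int.castRingHom A))).principal
  have hmem : ∀ c : ℤ, (c : A) ∈ q ↔ p ∣ c := by
    intro c
    rw [← Ideal.mem_span_singleton, ← Ideal.submodule_span_eq, ← hp]; rfl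
  by_cases hp0 : (p : A) = 0
  · refine ⟨f, hf, m, fun h => hm ?_⟩
    obtain ⟨c, hc⟩ := (hmem _).1 h
    rw [hc]; simp [hp0]
  · have hfin : FiniteMultiplicity (MvPolynomial.C p) f := by
      refine FiniteMultiplicity.of_not_isUnit ?_ ?_
      · intro hu
        have hu' : IsUnit p := by
          simpa using hu.map (MvPolynomial.constantCoeff (R := ℤ) (σ := Fin (S.card + 1)))
        have := (hmem 1).2 hu'.dvd
        simp at this
        exact hq.ne_top ((Ideal.eq_top_iff_one _).2 this)
      · rintro rfl
        simp at hm
    obtain ⟨g, hg, hg'⟩ := hfin.exists_eq_pow_mul_and_not_dvd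
    refine ⟨g, ?_, ?_⟩
    · rw [hg] at hf
      simp at hf
      exact hf.resolve_left (fun h => hp0 h.1)
    · rw [MvPolynomial.C_dvd_iff_dvd_coeff] at hg'
      push Not at hg'
      obtain ⟨m, hm⟩ := hg'
      exact ⟨m, fun h => hm ((hmem _).1 h)⟩

theorem no_chain {A : Type*} [CommRing A] [IsDomain A] (S : Finset A)
    (hS : ∀ a : A, ∃ y ∈ Subring.closure (S : Set A), ∃ z ∈ Subring.closure (S : Set A),
      z ≠ 0 ∧ z * a = y) (q : Fin (S.card + 1 + 1) → Ideal A) (hq : ∀ i, (q i).IsPrime)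
    (hmono : StrictMono q)
    (hc : ∀ c : ℤ, (c : A) ∈ q (Fin.last _) → (c : A) ∈ q 0) : False := by
  have : ∀ i : Fin (S.card + 1), ∃ x, x ∈ q i.succ ∧ x ∉ q i.castSucc := fun i =>
    Set.exists_of_ssubset (hmono (Fin.castSucc_lt_succ (i := i)))
  choose x hx1 hx0 using this
  have := hq 0
  obtain ⟨f, hf, m, hm⟩ := exists_relation S hS x (q 0)
  refine chain_lemma _ q hq hmono.monotone x hx1 hx0 (MvPolynomial.map (Int.castRingHom A) f)
    ?_ ⟨m, ?_⟩ ?_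
  · intro m
    rw [MvPolynomial.coeff_map]
    by_cases h : ((f.coeff m : ℤ) : A) ∈ q 0
    · exact Or.inl h
    · exact Or.inr fun h' => h (hc _ h')
  · rw [MvPolynomial.coeff_map]
    exact fun h' => hm (hc _ h')
  · have : MvPolynomial.eval x (MvPolynomial.map (Int.castRingHom A) f) = 0 := by
      rw [MvPolynomial.eval_map, ← hf]; rfl
    rw [this]; exact zero_mem _

theorem dim_bound {A : Type*} [CommRing A] [IsDomain A] (S : Finset A)
    (hS : ∀ a : A, ∃ y ∈ Subring.closure (S : Set A), ∃ z ∈ Subring.closure (S : Set A),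
      z ≠ 0 ∧ z * a = y) : ringKrullDim A ≠ ⊤ := by
  have hle : ringKrullDim A ≤ ((2 * S.card + 1 : ℕ) : WithBot ℕ∞) := by
    unfold ringKrullDim Order.krullDim
    refine iSup_le fun l => ?_
    by_contra hlt
    have hl : 2 * S.card + 2 ≤ l.length := by
      by_contra h
      exact hlt (by exact_mod_cast (by omega : l.length ≤ 2 * S.card + 1))
    have hsm : ∀ i j : Fin (l.length + 1), i < j → (l i).asIdeal < (l j).asIdeal :=
      fun i j hij => l.strictMono hij
    set r : Fin (l.length + 1) := ⟨S.card + 1, by omega⟩ with hr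
    by_cases h : ∀ c : ℤ, (c : A) ∈ (l r).asIdeal → (c : A) = 0
    · refine no_chain S hS (fun i => (l ⟨i, by omega⟩).asIdeal) (fun i => (l _).isPrime)
        (fun i j hij => hsm _ _ hij) ?_
      intro c hc
      rw [h c hc]; exact zero_mem _
    · push Not at h
      obtain ⟨d, hd, hd0⟩ := h
      refine no_chain S hS (fun i => (l ⟨S.card + 1 + i, by omega⟩).asIdeal)
        (fun i => (l _).isPrime)
        (fun i j hij => hsm _ _ (Nat.add_lt_add_left hij _)) ?_
      intro c hc
      have hp := (l r).isPrime
      have hp' : ((l r).asIdeal.comap (Int.castRingHom A)).IsPrime := Ideal.comap_isPrime _ _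
      have hmax : ((l r).asIdeal.comap (Int.castRingHom A)).IsMaximal := by
        refine hp'.isMaximal fun hb => hd0 ?_
        have : d ∈ (l r).asIdeal.comap (Int.castRingHom A) := hd
        rw [hb] at this
        rw [Ideal.mem_bot.1 this]; simp
      have hlt2 : S.card + 1 + (S.card + 1) < l.length + 1 := by omega
      have hpl := (l ⟨S.card + 1 + (S.card + 1), hlt2⟩).isPrime
      have heq := hmax.eq_of_le (Ideal.comap_isPrime (Int.castRingHom A)
        (l ⟨S.card + 1 + (S.card + 1), hlt2⟩).asIdeal).ne_top
        (Ideal.comap_mono (hsm r _ (by simp [hr, Fin.lt_def])).le)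
      have : c ∈ (l r).asIdeal.comap (Int.castRingHom A) := by rw [heq]; exact hc
      exact this
  intro h
  rw [h] at hle
  exact absurd hle (by
    rw [not_le]; exact WithBot.coe_lt_coe.2 (ENat.natCast_lt_top _))

theorem exists_good_poly {ι : Type*} [Finite ι] (κ : ι → Type*) [∀ i, Field (κ i)]
    (u : ∀ i, κ i) : ∃ f : Polynomial ℤ, f.Monic ∧ f.coeff 0 = 1 ∧ 0 < f.natDegree ∧
      ∀ i, Polynomial.aeval (u i) f ≠ 0 := by
  classical
  have := Fintype.ofFinite ι
  have : ∀ i, ∃ g : Polynomial ℤ, g.Monic ∧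
      ((∃ f : Polynomial ℤ, f.Monic ∧ f.coeff 0 = 1 ∧ Polynomial.aeval (u i) f = 0) →
        Polynomial.aeval (u i) g = 0) := by
    intro i
    by_cases h : ∃ f : Polynomial ℤ, f.Monic ∧ f.coeff 0 = 1 ∧ Polynomial.aeval (u i) f = 0
    · obtain ⟨f, h1, _, h3⟩ := h
      exact ⟨f, h1, fun _ => h3⟩
    · exact ⟨1, Polynomial.monic_one, fun h' => absurd h' h⟩
  choose g hg hg' using this
  have hm : (Polynomial.X * ∏ i, g i).Monic :=
    Polynomial.monic_X.mul (Polynomial.monic_prod_of_monic _ _ fun i _ => hg i)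
  have hd : 0 < (Polynomial.X * ∏ i, g i).natDegree := by
    rw [Polynomial.Monic.natDegree_mul Polynomial.monic_X
      (Polynomial.monic_prod_of_monic _ _ fun i _ => hg i), Polynomial.natDegree_X]
    omega
  have hd' : (1 : Polynomial ℤ).degree < (Polynomial.X * ∏ i, g i).degree := by
    rw [Polynomial.degree_one]
    exact Polynomial.natDegree_pos_iff_degree_pos.1 hd
  have hm' : (Polynomial.X * ∏ i, g i + 1).Monic := hm.add_of_left hd'
  have h0 : (Polynomial.X * ∏ i, g i + 1).coeff 0 = 1 := by simp
  refine ⟨_, hm', h0, ?_, ?_⟩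
  · rw [Polynomial.natDegree_add_eq_left_of_degree_lt hd']; exact hd
  · intro i h
    have h1 := hg' i ⟨_, hm', h0, h⟩
    simp only [map_add, map_mul, map_prod, map_one] at h
    rw [Finset.prod_eq_zero (Finset.mem_univ i) h1] at h
    simp at h

/-- Divisibility is local at maximal ideals. -/
theorem dvd_of_local {R : Type*} [CommRing R] (g h : R)
    (H : ∀ (m : Ideal R) [m.IsMaximal],
      algebraMap R (Localization.AtPrime m) g ∣ algebraMap R (Localization.AtPrime m) h) :
    g ∣ h := by
  rw [← Ideal.mem_span_singleton]
  refine Ideal.mem_of_localization_maximal fun m hm => ?_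
  rw [Ideal.map_span, Set.image_singleton, Ideal.mem_span_singleton]
  exact H m

theorem homog_local {L : Type*} [CommRing L] [IsLocalRing L] (hL : ∀ a b : L, a ∣ b ∨ b ∣ a)
    (a b : L) (f : Polynomial ℤ) (hf : f.Monic)
    (H : ∀ u : L, a = b * u → Polynomial.aeval (IsLocalRing.residue L u) f ≠ 0) (j : ℕ)
    (hj : j ≤ f.natDegree) :
    (∑ i ∈ Finset.range (f.natDegree + 1), (f.coeff i : L) * (a ^ i * b ^ (f.natDegree - i))) ∣
      a ^ j * b ^ (f.natDegree - j) := by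
  have case1 : ∀ u, a = b * u → (∑ i ∈ Finset.range (f.natDegree + 1),
      (f.coeff i : L) * (a ^ i * b ^ (f.natDegree - i))) ∣ a ^ j * b ^ (f.natDegree - j) := by
    intro u hu
    have hmon : ∀ i ≤ f.natDegree, a ^ i * b ^ (f.natDegree - i) = b ^ f.natDegree * u ^ i := by
      intro i hi
      rw [hu, mul_pow, mul_right_comm, ← pow_add, Nat.add_sub_cancel' hi]
    have hu' : IsUnit (Polynomial.aeval u f) := by
      rw [← IsLocalRing.residue_ne_zero_iff_isUnit]
      have := H u hu
      rw [Polynomial.aeval_def] at this ⊢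
      rwa [Polynomial.hom_eval₂, RingHom.ext_int ((IsLocalRing.residue L).comp _) (algebraMap ℤ _)]
    have hs : (∑ i ∈ Finset.range (f.natDegree + 1),
        (f.coeff i : L) * (a ^ i * b ^ (f.natDegree - i))) =
        b ^ f.natDegree * Polynomial.aeval u f := by
      rw [Polynomial.aeval_eq_sum_range, Finset.mul_sum]
      refine Finset.sum_congr rfl fun i hi => ?_
      rw [hmon i (by simpa [Nat.lt_succ_iff] using hi), zsmul_eq_mul]
      ring
    rw [hs, hmon j hj]
    exact (hu'.mul_right_dvd).2 (dvd_mul_right _ _)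
  rcases hL b a with ⟨u, hu⟩ | ⟨w, hw⟩
  · exact case1 u hu
  · by_cases hwu : IsUnit w
    · obtain ⟨w, rfl⟩ := hwu
      exact case1 (↑w⁻¹ : L) (by rw [hw]; simp)
    · have hmon : ∀ i ≤ f.natDegree, a ^ i * b ^ (f.natDegree - i) =
          a ^ f.natDegree * w ^ (f.natDegree - i) := by
        intro i hi
        rw [hw, mul_pow, ← mul_assoc, ← pow_add, Nat.add_sub_cancel' hi]
      have hs : (∑ i ∈ Finset.range (f.natDegree + 1),
          (f.coeff i : L) * (a ^ i * b ^ (f.natDegree - i))) =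
          a ^ f.natDegree * (∑ i ∈ Finset.range (f.natDegree + 1),
            (f.coeff i : L) * w ^ (f.natDegree - i)) := by
        rw [Finset.mul_sum]
        refine Finset.sum_congr rfl fun i hi => ?_
        rw [hmon i (by simpa [Nat.lt_succ_iff] using hi)]
        ring
      have hu' : IsUnit (∑ i ∈ Finset.range (f.natDegree + 1),
            (f.coeff i : L) * w ^ (f.natDegree - i)) := by
        rw [← IsLocalRing.residue_ne_zero_iff_isUnit, map_sum, Finset.sum_range_succ,
          Finset.sum_eq_zero]
        · simp [hf.coeff_natDegree]
        · intro i hi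
          have hw0 : IsLocalRing.residue L w = 0 := by
            rw [IsLocalRing.residue_eq_zero_iff]; exact hwu
          have : f.natDegree - i ≠ 0 := by
            have := Finset.mem_range.1 hi
            omega
          rw [map_mul, map_pow, hw0, zero_pow this, mul_zero]
      rw [hs, hmon j hj]
      exact (hu'.mul_right_dvd).2 (dvd_mul_right _ _)

theorem exists_coeffs {R : Type*} [CommRing R] [IsDomain R] (hP : IsPrueferDomain R)
    (hS : IsSemilocalRing R) (a b : R) (hb : b ≠ 0) :
    ∃ (k : ℕ) (n : ℕ → ℤ), 0 < k ∧
      (∑ i ∈ Finset.range (k + 1), (n i : R) * (a ^ i * b ^ (k - i))) ≠ 0 ∧ 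
      ∀ j ≤ k, (∑ i ∈ Finset.range (k + 1), (n i : R) * (a ^ i * b ^ (k - i))) ∣
        a ^ j * b ^ (k - j) := by
  classical
  have hfin : Finite (MaximalSpectrum R) := by
    have : Finite {m : Ideal R | m.IsMaximal} := hS
    exact Finite.of_injective (β := {m : Ideal R | m.IsMaximal})
      (fun m => ⟨m.asIdeal, m.isMaximal⟩) (fun m m' h => MaximalSpectrum.ext (by simpa using h))
  have hu : ∀ m : MaximalSpectrum R, ∃ v : IsLocalRing.ResidueField (Localization.AtPrime m.asIdeal),
      ∀ u : Localization.AtPrime m.asIdeal, algebraMap R _ a = algebraMap R _ b * u →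
        IsLocalRing.residue _ u = v := by
    intro m
    by_cases h : ∃ u : Localization.AtPrime m.asIdeal, algebraMap R _ a = algebraMap R _ b * u
    · obtain ⟨u, hu⟩ := h
      refine ⟨IsLocalRing.residue _ u, fun u' hu' => ?_⟩
      have hd : IsDomain (Localization.AtPrime m.asIdeal) := (hP.2 m.asIdeal).1
      have hb' : algebraMap R (Localization.AtPrime m.asIdeal) b ≠ 0 := by
        rw [Ne, IsLocalization.to_map_eq_zero_iff _ m.asIdeal.primeCompl_le_nonZeroDivisors]
        exact hb
      rw [mul_left_cancel₀ hb' (hu'.symm.trans hu)]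
    · exact ⟨0, fun u hu => absurd ⟨u, hu⟩ h⟩
  choose v hv using hu
  obtain ⟨f, hf, hf0, hfd, hfv⟩ := exists_good_poly _ v
  have hdvd : ∀ j ≤ f.natDegree, (∑ i ∈ Finset.range (f.natDegree + 1),
      (f.coeff i : R) * (a ^ i * b ^ (f.natDegree - i))) ∣ a ^ j * b ^ (f.natDegree - j) := by
    intro j hj
    refine dvd_of_local _ _ fun m hm => ?_
    have := homog_local (hP.2 m).2 (algebraMap R _ a) (algebraMap R _ b) f hf (fun u hu => by
      rw [hv ⟨m, hm⟩ u hu]; exact hfv ⟨m, hm⟩) j hj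
    simpa using this
  refine ⟨f.natDegree, f.coeff, hfd, fun h => ?_, hdvd⟩
  have := hdvd 0 (Nat.zero_le _)
  rw [h, zero_dvd_iff] at this
  simp [hb] at this

theorem pruefer_of_closed {R : Type*} [CommRing R] [IsDomain R] (hP : IsPrueferDomain R)
    (hS : IsSemilocalRing R) (A : Subring R)
    (hA : ∀ c : R, ∀ g ∈ A, ∀ h ∈ A, g ≠ 0 → g * c = h → c ∈ A) : IsPrueferDomain A := by
  refine ⟨inferInstance, fun q hq => ⟨IsLocalization.isDomain_localization
    q.primeCompl_le_nonZeroDivisors, ?_⟩⟩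
  have key : ∀ a b : A, algebraMap A (Localization.AtPrime q) a ∣ algebraMap A _ b ∨
      algebraMap A (Localization.AtPrime q) b ∣ algebraMap A _ a := by
    intro a b
    by_cases hb : b = 0
    · left; rw [hb, map_zero]; exact dvd_zero _
    obtain ⟨k, n, hk, hg, hdvd⟩ := exists_coeffs hP hS (a : R) (b : R) (by simpa using hb)
    have : ∀ j, ∃ c : A, j ≤ k → (∑ i ∈ Finset.range (k + 1),
        (n i : A) * (a ^ i * b ^ (k - i))) * c = a ^ j * b ^ (k - j) := by
      intro j
      by_cases hj : j ≤ k
      · obtain ⟨c, hc⟩ := hdvd j hj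
        have hcA : c ∈ A := hA c ((∑ i ∈ Finset.range (k + 1),
          (n i : A) * (a ^ i * b ^ (k - i)) : A) : R) (Subtype.property _)
          ((a ^ j * b ^ (k - j) : A) : R) (Subtype.property _)
          (by push_cast; exact hg) (by push_cast; exact hc.symm)
        exact ⟨⟨c, hcA⟩, fun _ => Subtype.ext (by push_cast; exact hc.symm)⟩
      · exact ⟨0, fun h => absurd h hj⟩
    choose c hc using this
    set g : A := ∑ i ∈ Finset.range (k + 1), (n i : A) * (a ^ i * b ^ (k - i)) with hgdef
    have hg0 : g ≠ 0 := by
      intro h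
      apply hg
      have := congrArg (Subtype.val) h
      rw [hgdef] at this
      push_cast at this
      exact this
    have hsum : ∑ i ∈ Finset.range (k + 1), (n i : A) * c i = 1 := by
      apply mul_left_cancel₀ hg0
      rw [mul_one, Finset.mul_sum]
      conv_rhs => rw [hgdef]
      refine Finset.sum_congr rfl fun i hi => ?_
      rw [← hc i (by simpa [Nat.lt_succ_iff] using hi)]
      ring
    have hrel : ∀ j < k, b * c (j + 1) = a * c j := by
      intro j hj
      apply mul_left_cancel₀ hg0
      have h1 := hc (j + 1) hj
      have h2 := hc j hj.le
      rw [show k - j = (k - (j + 1)) + 1 by omega] at h2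
      calc g * (b * c (j + 1)) = b * (g * c (j + 1)) := by ring
        _ = a * (g * c j) := by rw [h1, h2]; ring
        _ = g * (a * c j) := by ring
    have hex : ∃ j ≤ k, c j ∉ q := by
      by_contra hcon
      push Not at hcon
      apply hq.ne_top
      rw [Ideal.eq_top_iff_one, ← hsum]
      exact Ideal.sum_mem _ fun i hi => Ideal.mul_mem_left _ _
        (hcon i (by simpa [Nat.lt_succ_iff] using hi))
    obtain ⟨j, hj, hcj⟩ := hex
    have hunit : IsUnit (algebraMap A (Localization.AtPrime q) (c j)) :=
      IsLocalization.map_units (Localization.AtPrime q) (⟨c j, hcj⟩ : q.primeCompl)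
    rcases hj.lt_or_eq with hj | rfl
    · right
      rw [← hunit.dvd_mul_right, ← map_mul, ← hrel j hj, map_mul]
      exact dvd_mul_right _ _
    · left
      rw [← hunit.dvd_mul_right, ← map_mul]
      have := hrel (j - 1) (by omega)
      rw [Nat.sub_add_cancel hk] at this
      rw [this, map_mul]
      exact dvd_mul_right _ _
  intro x y
  obtain ⟨⟨a, s⟩, hx⟩ := IsLocalization.surj q.primeCompl x
  obtain ⟨⟨b, t⟩, hy⟩ := IsLocalization.surj q.primeCompl y
  have hs := IsLocalization.map_units (Localization.AtPrime q) s
  have ht := IsLocalization.map_units (Localization.AtPrime q) t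
  have := key a b
  rw [← hx, ← hy] at this
  simpa [hs.mul_right_dvd, ht.mul_right_dvd, hs.dvd_mul_right, ht.dvd_mul_right] using this

theorem semilocal_of_closed {R : Type*} [CommRing R] 
    (hS : IsSemilocalRing R) (A : Subring R)
    (hA : ∀ a c : R, a ∈ A → a * c = 1 → c ∈ A) : IsSemilocalRing A := by
  classical
  refine Set.Finite.subset (Set.Finite.image (Ideal.comap A.subtype) hS) fun q hq => ?_
  have hq : q.IsMaximal := hq
  have hsub : (q : Set A) ⊆ ⋃ m ∈ (hS.toFinset : Set (Ideal R)), (Ideal.comap A.subtype m : Set A) := by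
    intro a ha
    have hnu : ¬ IsUnit (a : R) := by
      intro hu
      obtain ⟨c, hc⟩ := hu.exists_right_inv
      refine hq.ne_top (Ideal.eq_top_of_isUnit_mem _ ha
        (IsUnit.of_mul_eq_one (⟨c, hA _ _ a.2 hc⟩ : A) (Subtype.ext hc)))
    obtain ⟨m, hm, ham⟩ := exists_max_ideal_of_mem_nonunits hnu
    simp only [Set.mem_iUnion]
    exact ⟨m, hS.mem_toFinset.2 hm, ham⟩
  rw [Ideal.subset_union_prime (⊤ : Ideal R) ⊤] at hsub
  · obtain ⟨m, hm, hle⟩ := hsub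
    have hm : m.IsMaximal := hS.mem_toFinset.1 hm
    exact ⟨m, hm, (hq.eq_of_le (Ideal.comap_isPrime A.subtype m).ne_top hle).symm⟩
  · intro m hm _ _
    have hm : m.IsMaximal := hS.mem_toFinset.1 hm
    exact Ideal.comap_isPrime _ _

/-- The elements of `R` which are fractions of elements of the subring `B`. -/
def fracClosure {R : Type*} [CommRing R] [IsDomain R] (B : Subring R) : Subring R where
  carrier := {x | ∃ y ∈ B, ∃ z ∈ B, z ≠ 0 ∧ z * x = y}
  zero_mem' := ⟨0, zero_mem _, 1, one_mem _, one_ne_zero, by simp⟩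
  one_mem' := ⟨1, one_mem _, 1, one_mem _, one_ne_zero, by simp⟩
  add_mem' := by
    rintro a b ⟨y, hy, z, hz, hz0, rfl⟩ ⟨y', hy', z', hz', hz0', rfl⟩
    exact ⟨z' * (z * a) + z * (z' * b), add_mem (mul_mem hz' hy) (mul_mem hz hy'), z * z',
      mul_mem hz hz', mul_ne_zero hz0 hz0', by ring⟩
  mul_mem' := by
    rintro a b ⟨y, hy, z, hz, hz0, rfl⟩ ⟨y', hy', z', hz', hz0', rfl⟩
    exact ⟨(z * a) * (z' * b), mul_mem hy hy', z * z',
      mul_mem hz hz', mul_ne_zero hz0 hz0', by ring⟩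
  neg_mem' := by
    rintro a ⟨y, hy, z, hz, hz0, rfl⟩
    exact ⟨-(z * a), neg_mem hy, z, hz, hz0, by ring⟩

theorem le_fracClosure {R : Type*} [CommRing R] [IsDomain R] (B : Subring R) :
    B ≤ fracClosure B := fun x hx => ⟨x, hx, 1, one_mem _, one_ne_zero, one_mul _⟩

theorem fracClosure_closed {R : Type*} [CommRing R] [IsDomain R] (B : Subring R) :
    ∀ c : R, ∀ g ∈ fracClosure B, ∀ h ∈ fracClosure B, g ≠ 0 → g * c = h →
      c ∈ fracClosure B := by
  rintro c g ⟨y, hy, z, hz, hz0, rfl⟩ h ⟨y', hy', z', hz', hz0', rfl⟩ hg rfl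
  exact ⟨z * (z' * (g * c)), mul_mem hz hy', z' * (z * g), mul_mem hz' hy,
    mul_ne_zero hz0' (mul_ne_zero hz0 hg), by ring⟩

/-- A semilocal Prüfer domain is the increasing (directed) union of a
family of subrings, each of which is a semilocal Prüfer domain of finite Krull
dimension. -/
theorem semilocal_prufer_directed_union_finite_dim (R : Type u) [CommRing R]
    [IsDomain R] (hPrufer : IsPrueferDomain R) (hSemilocal : IsSemilocalRing R) :
    ∃ (ι : Type u) (_ : Nonempty ι) (Rα : ι → Subring R),
      Directed (· ≤ ·) Rα ∧
      (∀ x : R, ∃ i, x ∈ Rα i) ∧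
      ∀ i, IsPrueferDomain (Rα i) ∧ IsSemilocalRing (Rα i) ∧
        ringKrullDim (Rα i) ≠ ⊤ := by
  classical
  refine ⟨Finset R, inferInstance, fun S => fracClosure (Subring.closure (S : Set R)),
    ?_, ?_, ?_⟩
  · refine Monotone.directed_le ?_
    rintro S T hST x ⟨y, hy, z, hz, hz0, h⟩
    have hle : Subring.closure (S : Set R) ≤ Subring.closure (T : Set R) :=
      Subring.closure_mono (by exact_mod_cast hST)
    exact ⟨y, hle hy, z, hle hz, hz0, h⟩
  · exact fun x => ⟨{x}, le_fracClosure _ (Subring.subset_closure (by simp))⟩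
  · intro S
    have hcl := fracClosure_closed (Subring.closure (S : Set R))
    refine ⟨pruefer_of_closed hPrufer hSemilocal _ hcl, semilocal_of_closed hSemilocal _ ?_, ?_⟩
    · intro a c ha hac
      exact hcl c a ha 1 (one_mem _) (by rintro rfl; simp at hac) hac
    · have hSA : ∀ x ∈ S, x ∈ fracClosure (Subring.closure (S : Set R)) :=
        fun x hx => le_fracClosure _ (Subring.subset_closure hx)
      change ringKrullDim (fracClosure (Subring.closure (S : Set R))) ≠ ⊤
      generalize hAdef : fracClosure (Subring.closure (S : Set R)) = A at hSA ⊢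
      have himg : ((S.attach.image fun x => (⟨x.1, hSA x.1 x.2⟩ : A) : Finset A) : Set A) =
          A.subtype ⁻¹' (S : Set R) := by
        ext x
        simp only [Finset.coe_image, Set.mem_image, Set.mem_preimage]
        constructor
        · rintro ⟨y, _, rfl⟩; exact y.2
        · intro hx; exact ⟨⟨x.1, hx⟩, by simp, rfl⟩
      have hlift : ∀ y ∈ Subring.closure (S : Set R), ∃ y' ∈ Subring.closure
          ((S.attach.image fun x => (⟨x.1, hSA x.1 x.2⟩ : A) : Finset A) : Set A),
          (y' : R) = y := by
        intro y hy
        have : Subring.closure (S : Set R) ≤ (Subring.closure ((S.attach.image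
            fun x => (⟨x.1, hSA x.1 x.2⟩ : A) : Finset A) : Set A)).map A.subtype := by
          rw [Subring.closure_le, himg]
          intro x hx
          exact ⟨⟨x, hSA x hx⟩, Subring.subset_closure hx, rfl⟩
        exact this hy
      refine dim_bound (S.attach.image fun x => (⟨x.1, hSA x.1 x.2⟩ : A)) ?_
      rintro ⟨a, ha⟩
      have ha' := ha
      rw [← hAdef] at ha'
      obtain ⟨y, hy, z, hz, hz0, h⟩ := ha'
      obtain ⟨y', hy', rfl⟩ := hlift y hy
      obtain ⟨z', hz', rfl⟩ := hlift z hz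
      exact ⟨y', hy', z', hz', by simpa using hz0, Subtype.ext h⟩
end

section
/- Let R be a semilocal Prüfer domain of finite Krull dimension with fraction field K, and let P be a set of prime ideals of R such that for each p ∈ P the residue field κ(p) is a finitely generated field extension of its prime subfield (i.e. κ(p) is generated as a field by a finite subset). Let K' ⊆ K be a subfield and set R' := R ∩ K' (intersection inside K). Then for each p ∈ P, the residue field of R' at the contracted prime p ∩ R' is also a finitely generated field extension of its prime subfield. -/
/-- The residue field `κ(p) = Frac(R/p)` of `R` at a prime `p` is a finitely generated
field extension of its prime subfield, i.e. it is generated as a field by a finite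
subset. -/
def ResidueFieldFinGen {R : Type*} [CommRing R] (p : Ideal R) (hp : p.IsPrime) : Prop :=
  haveI := hp
  ∃ s : Set (FractionRing (R ⧸ p)), s.Finite ∧ Subfield.closure s = ⊤

open scoped IntermediateField.algebraAdjoinAdjoin in
theorem aux_linearIndependent {F M L : Type*} [Field F] [Field M] [Field L] [Algebra F M]
    [Algebra M L] [Algebra F L] [IsScalarTower F M L] {σ ι : Type*} {c : σ → L}
    (hc : AlgebraicIndependent M c) {v : ι → M} (hv : LinearIndependent F v) :
    LinearIndependent (IntermediateField.adjoin F (Set.range c)) (fun i => algebraMap M L (v i)) := by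
  have h1 : LinearIndependent (Algebra.adjoin F (Set.range c))
      (fun i => algebraMap M L (v i)) := by
    rw [linearIndependent_iff']
    intro s g hg i hi
    have : ∀ i, ∃ q : MvPolynomial σ F, MvPolynomial.aeval c q = (g i : L) := by
      intro i
      have h := (Algebra.adjoin_range_eq_range_aeval F c).le (g i).2
      exact h
    choose q hq using this
    have h2 : MvPolynomial.aeval c (∑ i ∈ s, MvPolynomial.C (v i) *
        MvPolynomial.map (algebraMap F M) (q i)) = 0 := by
      rw [map_sum, ← hg]
      refine Finset.sum_congr rfl fun i _ => ?_
      rw [map_mul, MvPolynomial.aeval_C, MvPolynomial.aeval_map_algebraMap, hq,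
        Algebra.smul_def, mul_comm]
      rfl
    have h3 := (injective_iff_map_eq_zero _).1 hc _ h2
    have h4 : q i = 0 := by
      ext m
      have h5 := congrArg (MvPolynomial.coeff m) h3
      rw [MvPolynomial.coeff_sum] at h5
      simp only [MvPolynomial.coeff_C_mul, MvPolynomial.coeff_map, MvPolynomial.coeff_zero] at h5
      rw [linearIndependent_iff'] at hv
      refine hv s (fun i => MvPolynomial.coeff m (q i)) ?_ i hi
      rw [← h5]
      refine Finset.sum_congr rfl fun i _ => ?_
      rw [Algebra.smul_def, mul_comm]
    apply Subtype.ext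
    rw [← hq i, h4, map_zero]
    rfl
  exact (LinearIndependent.iff_fractionRing (Algebra.adjoin F (Set.range c))
    (IntermediateField.adjoin F (Set.range c))).1 h1

theorem aux_finite (F M L : Type*) [Field F] [Field M] [Field L] [Algebra F M]
    [Algebra M L] [Algebra F L] [IsScalarTower F M L] [Algebra.IsAlgebraic F M]
    [Algebra.EssFiniteType F L] : Module.Finite F M := by
  obtain ⟨s, hs⟩ := exists_isTranscendenceBasis M L
  have hsF : IsTranscendenceBasis F ((↑) : s → L) := by
    obtain ⟨t, ht⟩ := exists_isTranscendenceBasis F M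
    have hemp : IsEmpty t := ht.isEmpty_iff_isAlgebraic.2 inferInstance
    have h := (ht.sumElim_comp hs).to_subtype_range
    refine (ht.sumElim_comp hs).to_subtype_range' ?_
    rw [Set.Sum.elim_range, Set.range_eq_empty (algebraMap M L ∘ _), Set.union_empty,
      Subtype.range_coe]
  have halg := hsF.isAlgebraic_field
  have : Algebra.EssFiniteType (IntermediateField.adjoin F (Set.range ((↑) : s → L))) L :=
    Algebra.EssFiniteType.of_comp F _ L
  have := Algebra.finite_of_essFiniteType_of_isAlgebraic
    (F := IntermediateField.adjoin F (Set.range ((↑) : s → L))) (E := L)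
  let b := Module.Basis.ofVectorSpace F M
  have hli := aux_linearIndependent hs.1 b.linearIndependent
  have := hli.finite
  exact Module.Finite.of_basis b

theorem aux_ess (k M L : Type*) [Field k] [Field M] [Field L] [Algebra k M]
    [Algebra M L] [Algebra k L] [IsScalarTower k M L]
    [Algebra.EssFiniteType k L] : Algebra.EssFiniteType k M := by
  obtain ⟨s, hs⟩ := exists_isTranscendenceBasis k M
  have hfin : Finite s := finite_of_algebraicIndependent (K := k) (L := L)
    (x := fun i : s => algebraMap M L i)
    (hs.1.map' (f := IsScalarTower.toAlgHom k M L) (algebraMap M L).injective)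
  have halg := hs.isAlgebraic_field
  have : Algebra.EssFiniteType (IntermediateField.adjoin k (Set.range ((↑) : s → M))) L :=
    Algebra.EssFiniteType.of_comp k _ L
  have := aux_finite (IntermediateField.adjoin k (Set.range ((↑) : s → M))) M L
  have : Algebra.EssFiniteType k (IntermediateField.adjoin k (Set.range ((↑) : s → M))) :=
    IntermediateField.essFiniteType_iff.2 (IntermediateField.fg_adjoin_of_finite (Set.finite_range _))
  exact Algebra.EssFiniteType.comp k (IntermediateField.adjoin k (Set.range ((↑) : s → M))) M

theorem aux_field {M L : Type*} [Field M] [Field L] (f : M →+* L)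
    (h : ∃ s : Set L, s.Finite ∧ Subfield.closure s = ⊤) :
    ∃ s : Set M, s.Finite ∧ Subfield.closure s = ⊤ := by
  let := f.toAlgebra
  obtain ⟨s, hs, hcl⟩ := h
  have : Algebra.EssFiniteType (⊥ : Subfield M) L := by
    rw [← IntermediateField.fg_top_iff, IntermediateField.fg_def]
    refine ⟨s, hs, top_le_iff.1 fun x _ => ?_⟩
    have : Subfield.closure s ≤ (IntermediateField.adjoin (⊥ : Subfield M) s).toSubfield :=
      Subfield.closure_le.2 (IntermediateField.subset_adjoin _ _)
    rw [hcl] at this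
    exact this (Subfield.mem_top x)
  have := aux_ess (⊥ : Subfield M) M L
  obtain ⟨⟨t, ht⟩⟩ := Field.fg_iff_essFiniteType.2 this
  exact ⟨t, t.finite_toSet, ht⟩

/-- Let `R` be a semilocal Prüfer domain of finite Krull dimension with
fraction field `K`, and `P` a set of primes of `R` at which the residue fields are
finitely generated over their prime subfields. For a subfield `K' ⊆ K`, the subring
`R' = R ∩ K'` again has finitely generated residue fields at the contractions of the
primes in `P`. -/
theorem contracted_residue_fields_finitely_generated (R : Type*) [CommRing R]
    [IsDomain R] (hPrufer : IsPrueferDomain R) (hSemilocal : IsSemilocalRing R)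
    (hdim : ringKrullDim R ≠ ⊤)
    (P : Set (Ideal R)) (hP : ∀ p ∈ P, p.IsPrime)
    (hfg : ∀ p (hp : p ∈ P), ResidueFieldFinGen p (hP p hp))
    (K' : Subfield (FractionRing R)) :
    letI R' : Subring R := K'.toSubring.comap (algebraMap R (FractionRing R))
    ∀ p (_ : p ∈ P), ∃ hq : (Ideal.comap R'.subtype p).IsPrime,
      ResidueFieldFinGen (Ideal.comap R'.subtype p) hq := by
  intro p hp
  have hpp : p.IsPrime := hP p hp
  have hq : (Ideal.comap (Subring.subtype
    (K'.toSubring.comap (algebraMap R (FractionRing R)))) p).IsPrime := Ideal.comap_isPrime _ p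
  refine ⟨hq, ?_⟩
  let g := Ideal.quotientMap p (Subring.subtype
    (K'.toSubring.comap (algebraMap R (FractionRing R)))) le_rfl
  have hg : Function.Injective g := Ideal.quotientMap_injective
  exact aux_field (IsFractionRing.map hg) (hfg p hp)
end

section
/- Let V be a valuation ring with maximal ideal m, let A be an integral domain which is a smooth V-algebra (i.e. A is finitely presented and formally smooth over V), and let P be a nonempty finite set of prime ideals of A each of which is minimal among the primes of A containing the extended ideal mA (i.e. P consists of generic points of the V-special fibre of Spec A). Let A_P denote the localisation of A at the multiplicative set A \ ⋃_{p∈P} p. Then A_P is a semilocal Prüfer domain and the structure homomorphism V → A_P is injective and faithfully flat. -/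
/-- The multiplicative set `A \ ⋃_{p ∈ P} p`, the complement of a union of primes. -/
def primesCompl {A : Type*} [CommRing A] (P : Set (Ideal A))
    (hP : ∀ p ∈ P, p.IsPrime) : Submonoid A where
  carrier := {x | ∀ p ∈ P, x ∉ p}
  one_mem' := fun p hp h => (hP p hp).ne_top ((Ideal.eq_top_iff_one p).mpr h)
  mul_mem' := fun {a b} ha hb p hp hab =>
    ((hP p hp).mem_or_mem hab).elim (fun h => ha p hp h) (fun h => hb p hp h)

section Helpers

open Polynomial TensorProduct

theorem seid (B F : Type*) [CommRing B] [IsDomain B] [IsLocalRing B] [IsIntegrallyClosed B] [Field F]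
    [Algebra B F] [IsFractionRing B F] (x : F) : ∀ (n : ℕ) (g : B[X]), g.natDegree ≤ n →
    aeval x g = 0 → (∃ i, IsUnit (g.coeff i)) →
    (∃ b : B, algebraMap B F b = x) ∨ ∃ b : B, algebraMap B F b = x⁻¹ := by
  have key (g : B[X]) (h : aeval x g = 0) : ∃ b : B, algebraMap B F b = g.leadingCoeff • x := by
    exact IsIntegrallyClosed.isIntegral_iff.1 (isIntegral_leadingCoeff_smul g x h)
  intro n
  induction n with
  | zero =>
    intro g hg h0 ⟨i, hi⟩
    rw [eq_C_of_natDegree_le_zero hg] at h0 hi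
    exfalso
    simp only [aeval_C, map_eq_zero_iff _ (IsFractionRing.injective B F)] at h0
    simp [h0] at hi
  | succ n ih =>
    intro g hg h0 ⟨i, hi⟩
    by_cases hd : g.natDegree ≤ n
    · exact ih g hd h0 ⟨i, hi⟩
    have hdeg : g.natDegree = n + 1 := by omega
    obtain ⟨c, hc⟩ := key g h0
    by_cases hcu : IsUnit c
    · right
      obtain ⟨u, rfl⟩ := hcu
      refine ⟨↑u⁻¹ * g.leadingCoeff, ?_⟩
      rw [Algebra.smul_def] at hc
      have hu : algebraMap B F (↑u⁻¹) * algebraMap B F ↑u = 1 := by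
        rw [← map_mul]; simp
      have hx : x ≠ 0 := by
        rintro rfl
        rw [mul_zero] at hc
        rw [hc] at hu; simp at hu
      rw [map_mul]
      field_simp
      rw [mul_assoc, ← hc, hu]
    by_cases hlu : IsUnit g.leadingCoeff
    · left
      obtain ⟨u, hu⟩ := hlu
      refine ⟨↑u⁻¹ * c, ?_⟩
      rw [map_mul, hc, ← hu, Algebra.smul_def, ← mul_assoc, ← map_mul]
      simp
    -- lower the degree
    let g' : B[X] := g.eraseLead + C c * X ^ n
    have hg' : aeval x g' = 0 := by
      rw [← h0]
      conv_rhs => rw [← eraseLead_add_C_mul_X_pow g]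
      simp only [g', map_add, map_mul, aeval_C, hc, map_pow, aeval_X, hdeg, Algebra.smul_def]
      ring
    have hin : i ≠ n + 1 := by
      rintro rfl
      apply hlu
      rwa [leadingCoeff, hdeg]
    refine ih g' ?_ hg' ⟨i, ?_⟩
    · refine natDegree_add_le_of_degree_le ?_ (natDegree_C_mul_X_pow_le _ _)
      have := eraseLead_natDegree_le g
      omega
    · have : g'.coeff i = g.coeff i + (if i = n then c else 0) := by
        simp [g', eraseLead_coeff, hdeg, hin]
      rw [this]
      split_ifs
      · by_contra hh
        have h1 : c ∈ IsLocalRing.maximalIdeal B := hcu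
        have h2 : g.coeff i + c ∈ IsLocalRing.maximalIdeal B := hh
        have := Ideal.sub_mem _ h2 h1
        rw [add_sub_cancel_right] at this
        exact this hi
      · simpa using hi

theorem content (V : Type*) [CommRing V] [IsDomain V] [ValuationRing V] {ι : Type*} (s : Finset ι)
   (c : ι → V) (h : ∃ i ∈ s, c i ≠ 0) : ∃ i ∈ s, c i ≠ 0 ∧ ∀ j ∈ s, c i ∣ c j := by
  classical
  induction s using Finset.induction_on with
  | empty => simp at h
  | insert a s ha ih =>
    by_cases h' : ∃ i ∈ s, c i ≠ 0
    · obtain ⟨i, hi, h0, hd⟩ := ih h'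
      rcases ValuationRing.dvd_total (c i) (c a) with h1 | h1
      · exact ⟨i, by simp [hi], h0, by simpa [h1] using hd⟩
      · refine ⟨a, by simp, fun h => h0 ?_, ?_⟩
        · rw [h] at h1; exact zero_dvd_iff.1 h1
        · simpa using fun j hj => h1.trans (hd j hj)
    · push Not at h'
      obtain ⟨i, hi, h0⟩ := h
      have : i = a := by
        by_contra hne
        exact h0 (h' i (by simpa [hne] using hi))
      subst this
      exact ⟨i, by simp, h0, by simpa using fun j hj => by simp [h' j hj]⟩

theorem mvnormal (V : Type*) [CommRing V] [IsDomain V] [IsIntegrallyClosed V] (n : ℕ): IsIntegrallyClosed (MvPolynomial (Fin n) V) := by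
  induction n with
  | zero => exact .of_equiv (MvPolynomial.isEmptyAlgEquiv V (Fin 0)).symm.toRingEquiv
  | succ n ih => exact .of_equiv (MvPolynomial.finSuccEquiv V n).symm.toRingEquiv

theorem etnormal (R S : Type u) [CommRing R] [IsDomain R] [IsIntegrallyClosed R] [CommRing S] [IsDomain S]
   [Algebra R S] [Algebra.Etale R S] (hinj : Function.Injective (algebraMap R S)) : IsIntegrallyClosed S ∧ Algebra.IsAlgebraic R S := by
  let L := FractionRing R
  have hL : Algebra.IsAlgebraic R L := IsLocalization.isAlgebraic L (nonZeroDivisors R)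
  have hM : Algebra.algebraMapSubmonoid S (nonZeroDivisors R) ≤ nonZeroDivisors S := by
    rintro _ ⟨r, hr, rfl⟩
    exact mem_nonZeroDivisors_of_ne_zero (by
      rw [Ne, map_eq_zero_iff _ hinj]
      exact nonZeroDivisors.ne_zero hr)
  have hd' : IsDomain (L ⊗[R] S) := (Algebra.TensorProduct.comm R L S).toRingEquiv.isDomain_iff.2
      (IsLocalization.isDomain_of_le_nonZeroDivisors (S ⊗[R] L) hM)
  have hd : IsDomain (S ⊗[R] L) := IsLocalization.isDomain_of_le_nonZeroDivisors (S ⊗[R] L) hM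
  have hfin : Module.Finite L (L ⊗[R] S) := Algebra.FormallyUnramified.finite_of_free L _
  have hfield' : IsField (L ⊗[R] S) := isField_of_isIntegral_of_isField' (Field.toIsField L)
  have hfield : IsField (S ⊗[R] L) :=
    (Algebra.TensorProduct.comm R S L).toMulEquiv.isField hfield'
  have hSinj : Function.Injective (algebraMap S (S ⊗[R] L)) :=
    IsLocalization.injective _ hM
  have halg : Algebra.IsAlgebraic R (L ⊗[R] S) := Algebra.IsAlgebraic.trans R L _
  have hfr : IsFractionRing S (S ⊗[R] L) := by
    refine IsLocalization.of_le (Algebra.algebraMapSubmonoid S (nonZeroDivisors R)) _ hM ?_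
    intro s hs
    obtain ⟨t, ht⟩ := hfield.mul_inv_cancel (a := algebraMap S (S ⊗[R] L) s) (by
      rw [Ne, map_eq_zero_iff _ hSinj]
      exact nonZeroDivisors.ne_zero hs)
    exact IsUnit.of_mul_eq_one t ht
  refine ⟨?_, ?_⟩
  · rw [isIntegrallyClosed_iff (S ⊗[R] L)]
    intro x hx
    obtain ⟨y, hy⟩ := (TensorProduct.toIntegralClosure_bijective_of_smooth (R := R) (S := S) (B := L)).2 ⟨x, hx⟩
    have hy' : Algebra.TensorProduct.map (.id S S) (integralClosure R L).val y = x := congr_arg Subtype.val hy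
    rw [← hy']
    clear hx hy hy'
    induction y with
    | zero => exact ⟨0, by simp⟩
    | add a b ha hb =>
      obtain ⟨a', ha⟩ := ha
      obtain ⟨b', hb⟩ := hb
      exact ⟨a' + b', by rw [map_add, map_add, ha, hb]⟩
    | tmul s l =>
      obtain ⟨r, hr⟩ := IsIntegrallyClosed.isIntegral_iff.1 l.2
      refine ⟨r • s, ?_⟩
      change (r • s) ⊗ₜ[R] (1 : L) = s ⊗ₜ[R] (l : L)
      rw [← hr, Algebra.algebraMap_eq_smul_one, TensorProduct.smul_tmul]
  · exact Algebra.IsAlgebraic.of_injective ((Algebra.TensorProduct.comm R S L).toAlgHom.comp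
     (Algebra.TensorProduct.includeLeft : S →ₐ[R] S ⊗[R] L)) ((Algebra.TensorProduct.comm R S L).injective.comp hSinj)

/-- Every nonzero polynomial over `V[t]` is a nonzero constant times one of unit content. -/
theorem primitive_part (V : Type*) [CommRing V] [IsDomain V] [ValuationRing V] (n : ℕ)
    (g : (MvPolynomial (Fin n) V)[X]) (hg : g ≠ 0) :
    ∃ (v : V) (h : (MvPolynomial (Fin n) V)[X]), v ≠ 0 ∧ g = C (MvPolynomial.C v) * h ∧
      ∃ i d, IsUnit ((h.coeff i).coeff d) := by
  classical
  let c : ℕ × (Fin n →₀ ℕ) → V := fun x => (g.coeff x.1).coeff x.2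
  let s : Finset (ℕ × (Fin n →₀ ℕ)) := g.support ×ˢ g.support.biUnion fun i => (g.coeff i).support
  have hs : ∀ x, c x ≠ 0 → x ∈ s := by
    rintro ⟨i, d⟩ hx
    have h1 : g.coeff i ≠ 0 := by
      intro h; simp [c, h] at hx
    simp only [s, Finset.mem_product, Polynomial.mem_support_iff, Finset.mem_biUnion]
    exact ⟨h1, i, h1, by simpa [c] using hx⟩
  obtain ⟨⟨i, d⟩, hi, h0, hd⟩ := content V s c (by
    obtain ⟨i, hi⟩ : ∃ i, g.coeff i ≠ 0 := by
      by_contra! h; exact hg (Polynomial.ext (by simpa using h))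
    obtain ⟨d, hd⟩ := MvPolynomial.ne_zero_iff.1 hi
    exact ⟨(i, d), hs (i, d) hd, hd⟩)
  have hall : ∀ x, c (i, d) ∣ c x := by
    intro x
    by_cases hx : c x = 0
    · simp [hx]
    · exact hd x (hs x hx)
  have hdvd : C (MvPolynomial.C (c (i, d))) ∣ g := by
    rw [Polynomial.C_dvd_iff_dvd_coeff]
    intro j
    rw [MvPolynomial.C_dvd_iff_dvd_coeff]
    intro e
    exact hall (j, e)
  obtain ⟨h, hh⟩ := hdvd
  refine ⟨c (i, d), h, h0, hh, i, d, ?_⟩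
  have : c (i, d) = c (i, d) * (h.coeff i).coeff d := by
    conv_lhs => simp only [c]; rw [hh]
    simp
  have := mul_left_cancel₀ h0 ((mul_one _).trans this)
  rw [← this]; exact isUnit_one

theorem val_of (R B : Type*) [CommRing R] [IsDomain R] [CommRing B] [IsDomain B] [Algebra R B]
    [IsLocalRing B] [IsIntegrallyClosed B] [Algebra.IsAlgebraic R B]
    (hinj : Function.Injective (algebraMap R B))
    (H : ∀ g : R[X], g ≠ 0 → ∃ (v : R) (h : R[X]), v ≠ 0 ∧ g = C v * h ∧
      ∃ i, IsUnit (algebraMap R B (h.coeff i))) : ValuationRing B := by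
  let F := FractionRing B
  have hB : Algebra.IsAlgebraic B F := IsLocalization.isAlgebraic F (nonZeroDivisors B)
  have : Algebra.IsAlgebraic R F := .trans R B F
  rw [ValuationRing.iff_isInteger_or_isInteger B F]
  intro x
  obtain ⟨g, hg0, hgx⟩ := Algebra.IsAlgebraic.isAlgebraic (R := R) x
  obtain ⟨v, h, hv, rfl, i, hid⟩ := H g hg0
  have hx : aeval x h = 0 := by
    rw [map_mul, aeval_C, mul_eq_zero] at hgx
    refine hgx.resolve_left ?_
    rw [IsScalarTower.algebraMap_apply R B F,
      map_eq_zero_iff _ (IsFractionRing.injective B F), map_eq_zero_iff _ hinj]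
    exact hv
  refine seid B F x _ (h.map (algebraMap R B)) le_rfl (by simpa using hx) ⟨i, ?_⟩
  rwa [coeff_map]

theorem local_val (V : Type u) [CommRing V] [IsDomain V] [ValuationRing V]
    (A : Type u) [CommRing A] [IsDomain A] [Algebra V A] [Algebra.Smooth V A]
    (p : Ideal A) [hp : p.IsPrime] 
    (hmin : p ∈ (Ideal.map (algebraMap V A) (IsLocalRing.maximalIdeal V)).minimalPrimes) :
    ValuationRing (Localization.AtPrime p) := by
  obtain ⟨f, hf, n, algRS, tower, et⟩ :=
    Algebra.IsSmoothAt.exists_isStandardEtale_mvPolynomial (R := V) (p := p)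
  let R := MvPolynomial (Fin n) V
  let S := Localization.Away f
  let B := Localization.AtPrime p
  have hf0 : f ≠ 0 := by rintro rfl; exact hf (zero_mem p)
  have hle : Submonoid.powers f ≤ p.primeCompl := Submonoid.powers_le.2 hf
  have hle0 : Submonoid.powers f ≤ nonZeroDivisors A := powers_le_nonZeroDivisors_of_noZeroDivisors hf0
  have : IsDomain S := IsLocalization.isDomain_of_le_nonZeroDivisors S hle0
  let _ : Algebra S B := IsLocalization.localizationAlgebraOfSubmonoidLe S B _ _ hle
  have : IsScalarTower A S B := IsLocalization.localization_isScalarTower_of_submonoid_le S B _ _ hle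
  have hlocSB : IsLocalization (p.primeCompl.map (algebraMap A S)) B :=
    IsLocalization.isLocalization_of_submonoid_le S B _ _ hle
  let _ : Algebra R B := ((algebraMap S B).comp (algebraMap R S)).toAlgebra
  have : IsScalarTower R S B := .of_algebraMap_eq' rfl
  have : Algebra.Etale R S := inferInstance
  have : IsIntegrallyClosed R := mvnormal V n
  have hRSinj : Function.Injective (algebraMap R S) := FaithfulSMul.algebraMap_injective R S
  obtain ⟨hn, halg⟩ := etnormal R S hRSinj
  have hM : p.primeCompl.map (algebraMap A S) ≤ nonZeroDivisors S := by
    rintro _ ⟨a, ha, rfl⟩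
    refine mem_nonZeroDivisors_of_ne_zero ?_
    rw [Ne, map_eq_zero_iff _ (IsLocalization.injective S hle0)]
    rintro rfl
    exact ha (zero_mem p)
  have hBn : IsIntegrallyClosed B := isIntegrallyClosed_of_isLocalization B _ hM
  have hSBinj : Function.Injective (algebraMap S B) := IsLocalization.injective B hM
  have : Module.Flat S B := IsLocalization.flat B (p.primeCompl.map (algebraMap A S))
  have : Module.Flat R B := .trans R S B
  have hBalg : Algebra.IsAlgebraic R B := by
    have := IsLocalization.isAlgebraic B (p.primeCompl.map (algebraMap A S))
    exact .trans R S B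
  -- elements outside `mR` become units
  have hunit : ∀ r : R, r ∉ Ideal.map (MvPolynomial.C : V →+* R) (IsLocalRing.maximalIdeal V) →
      IsUnit (algebraMap R B r) := by
    intro r hr
    by_contra hu
    let m := IsLocalRing.maximalIdeal B
    have hmp : m.comap (algebraMap A B) = p := Localization.AtPrime.under_maximalIdeal
    let mR := Ideal.map (MvPolynomial.C : V →+* R) (IsLocalRing.maximalIdeal V)
    have : mR.IsPrime := by
      have : mR = RingHom.ker (MvPolynomial.map (σ := Fin n) (IsLocalRing.residue V)) := by
        rw [MvPolynomial.ker_map, IsLocalRing.ker_residue]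
      rw [this]
      exact RingHom.ker_isPrime _
    have hcomp : (algebraMap R B).comp MvPolynomial.C =
        ((algebraMap A B).comp (algebraMap V A)) := by
      ext v
      change algebraMap S B (algebraMap R S (algebraMap V R v)) = algebraMap A B (algebraMap V A v)
      rw [← IsScalarTower.algebraMap_apply V R S, IsScalarTower.algebraMap_apply A S B,
        IsScalarTower.algebraMap_apply V A S]
    have hle : mR ≤ m.under R := by
      rw [Ideal.map_le_iff_le_comap, Ideal.under, Ideal.comap_comap, hcomp, ← Ideal.comap_comap,
        hmp, ← Ideal.map_le_iff_le_comap]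
      exact hmin.1.2
    have hgd : Algebra.HasGoingDown R B := Algebra.HasGoingDown.of_flat
    obtain ⟨Q, hQ, hQp, hQl⟩ := Ideal.exists_ideal_le_liesOver_of_le (q := m.under R) m hle
    have hQA : p ≤ Q.comap (algebraMap A B) := by
      refine hmin.2 ⟨inferInstance, ?_⟩ ((Ideal.comap_mono hQ).trans hmp.le)
      rw [Ideal.map_le_iff_le_comap, Ideal.comap_comap, ← hcomp, ← Ideal.comap_comap,
        ← Ideal.map_le_iff_le_comap]
      exact hQl.over.le
    have hmQ : m ≤ Q := by
      have h1 : Ideal.map (algebraMap A B) p = m := Localization.AtPrime.map_eq_maximalIdeal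
      rw [← h1, Ideal.map_le_iff_le_comap]
      exact hQA
    apply hr
    have h1 : r ∈ Q.under R := hmQ hu
    rwa [← hQl.over] at h1
  refine val_of R B (hSBinj.comp hRSinj) fun g hg => ?_
  obtain ⟨v, h, hv, rfl, i, d, hid⟩ := primitive_part V n g hg
  refine ⟨MvPolynomial.C v, h, fun h0 => hv (MvPolynomial.C_injective _ _ (by rw [h0, map_zero])), rfl, i, hunit _ ?_⟩
  rw [MvPolynomial.mem_map_C_iff]
  exact fun hh => hh d hid

theorem faithfullyFlat_aux (V A T : Type*) [CommRing V] [IsLocalRing V] [CommRing A] [CommRing T]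
    [Algebra V A] [Algebra A T] [Algebra V T] [IsScalarTower V A T] [Module.Flat V A] [Module.Flat A T] (p : Ideal A)
    (hp : Ideal.map (algebraMap A T) p ≠ ⊤)
    (hm : Ideal.map (algebraMap V A) (IsLocalRing.maximalIdeal V) ≤ p) :
    Module.FaithfullyFlat V T := by
  have : Module.Flat V T := .trans V A T
  refine ⟨fun m hmm => ?_⟩
  rw [IsLocalRing.eq_maximalIdeal hmm, Ideal.smul_top_eq_map]
  intro htop
  apply hp
  rw [Submodule.restrictScalars_eq_top_iff] at htop
  rw [eq_top_iff, ← htop, IsScalarTower.algebraMap_eq V A T, ← Ideal.map_map]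
  exact Ideal.map_mono hm

end Helpers

/-- Let `V` be a valuation ring with maximal ideal `m`, `A` an integral
domain that is a smooth `V`-algebra and `P` a nonempty finite set of primes of `A`, each
minimal over `mA`.  Then the semilocalisation `A_P` of `A` at `P` is a semilocal Prüfer
domain and `V → A_P` is injective and faithfully flat. -/
theorem semilocalization_at_special_fibre_prufer
    (V : Type u) [CommRing V] [IsDomain V] [ValuationRing V]
    (A : Type u) [CommRing A] [IsDomain A] [Algebra V A] [Algebra.Smooth V A]
    (P : Set (Ideal A)) (hne : P.Nonempty) (hfin : P.Finite)
    (hP : ∀ p ∈ P, p.IsPrime)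
    (hmin : ∀ p ∈ P,
      p ∈ (Ideal.map (algebraMap V A) (IsLocalRing.maximalIdeal V)).minimalPrimes) :
    letI AP := Localization (primesCompl P hP)
    IsPrueferDomain AP ∧ IsSemilocalRing AP ∧
      Function.Injective ((algebraMap A AP).comp (algebraMap V A)) ∧
      (letI : Algebra V AP := ((algebraMap A AP).comp (algebraMap V A)).toAlgebra
       Module.FaithfullyFlat V AP) := by
  let AP := Localization (primesCompl P hP)
  have hle0 : primesCompl P hP ≤ nonZeroDivisors A := by
    intro x hx
    refine mem_nonZeroDivisors_of_ne_zero ?_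
    rintro rfl
    obtain ⟨p, hp⟩ := hne
    exact hx p hp (zero_mem p)
  have hdom : IsDomain AP := IsLocalization.isDomain_of_le_nonZeroDivisors AP hle0
  -- every prime of `AP` lies below one of the primes in `P`
  have hprime : ∀ Q : Ideal AP, Q.IsPrime → ∃ p ∈ P, Q.comap (algebraMap A AP) ≤ p := by
    intro Q hQ
    have h1 : ((Q.comap (algebraMap A AP) : Ideal A) : Set A) ⊆
        ⋃ i ∈ (hfin.toFinset : Set (Ideal A)), ((id i : Ideal A) : Set A) := by
      intro x hx
      by_contra hx'
      simp only [Set.Finite.coe_toFinset, id, Set.mem_iUnion, not_exists] at hx'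
      have hxm : x ∈ primesCompl P hP := fun p hp hxp => hx' p hp hxp
      exact hQ.ne_top (Ideal.eq_top_of_isUnit_mem _ hx (IsLocalization.map_units AP ⟨x, hxm⟩))
    have h2 := (Ideal.subset_union_prime (s := hfin.toFinset) (f := id) ⊤ ⊤
      (fun i hi _ _ => hP i (by simpa using hi))).1 h1
    simpa using h2
  have hmap : ∀ p ∈ P, (Ideal.map (algebraMap A AP) p).IsPrime := by
    intro p hp
    refine IsLocalization.isPrime_of_isPrime_disjoint (primesCompl P hP) AP p (hP p hp) ?_
    rw [Set.disjoint_left]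
    exact fun x hx hxp => hx p hp hxp
  have hVA : Function.Injective (algebraMap V A) := FaithfulSMul.algebraMap_injective V A
  have hAinj : Function.Injective (algebraMap A AP) := IsLocalization.injective AP hle0
  refine ⟨⟨hdom, ?_⟩, ?_, hAinj.comp hVA, ?_⟩
  · intro Q hQ
    refine ⟨inferInstance, ?_⟩
    obtain ⟨p, hp, hQp⟩ := hprime Q hQ
    have hpp := hP p hp
    have hval := local_val V A p (hmin p hp)
    let B := Localization.AtPrime Q
    let q := Q.comap (algebraMap A AP)
    have hloc : IsLocalization.AtPrime B q :=
      IsLocalization.isLocalization_isLocalization_atPrime_isLocalization (primesCompl P hP) B Q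
    have hle : p.primeCompl ≤ q.primeCompl := fun x hx hxq => hx (hQp hxq)
    let φ : Localization.AtPrime p →+* B :=
      IsLocalization.map B (RingHom.id A) (M := p.primeCompl) (T := q.primeCompl) hle
    have hφ : ∀ a : A, φ (algebraMap A _ a) = algebraMap A B a := fun a =>
      IsLocalization.map_eq (S := Localization.AtPrime p) (Q := B) (g := RingHom.id A) hle a
    have key : ∀ a b : A, algebraMap A B a ∣ algebraMap A B b ∨
        algebraMap A B b ∣ algebraMap A B a := by
      intro a b
      rw [← hφ, ← hφ]
      exact (ValuationRing.dvd_total (algebraMap A (Localization.AtPrime p) a)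
        (algebraMap A (Localization.AtPrime p) b)).imp (map_dvd φ) (map_dvd φ)
    have hassoc : ∀ x : B, ∃ a : A, Associated x (algebraMap A B a) := by
      intro x
      obtain ⟨⟨a, s⟩, hs⟩ := IsLocalization.surj q.primeCompl x
      obtain ⟨u, hu⟩ := IsLocalization.map_units B s
      exact ⟨a, u, by rw [hu]; exact hs⟩
    intro x y
    obtain ⟨a, ha⟩ := hassoc x
    obtain ⟨b, hb⟩ := hassoc y
    rw [ha.dvd_iff_dvd_left, hb.dvd_iff_dvd_right, hb.dvd_iff_dvd_left, ha.dvd_iff_dvd_right]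
    exact key a b
  · refine (hfin.image (Ideal.map (algebraMap A AP))).subset ?_
    intro M hM
    have hM : M.IsMaximal := hM
    obtain ⟨p, hp, hMp⟩ := hprime M hM.isPrime
    refine ⟨p, hp, (hM.eq_of_le (hmap p hp).ne_top ?_).symm⟩
    rw [← IsLocalization.map_under (primesCompl P hP) AP M]
    exact Ideal.map_mono hMp
  · obtain ⟨p, hp⟩ := hne
    have : Module.Flat A AP := IsLocalization.flat AP (primesCompl P hP)
    exact faithfullyFlat_aux V A AP p (hmap p hp).ne_top (hmin p hp).1.2
end

section
/- Let R be a Prüfer domain and let A be a finitely presented R-algebra. Then A is a coherent ring: every finitely generated ideal I of A is finitely presented as an A-module. -/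
lemma prufer_total {R : Type*} [CommRing R] (hP : IsPrueferDomain R) (q : Ideal R) [q.IsPrime]
    (a b : R) : (∃ s ∉ q, ∃ r, s * b = r * a) ∨ (∃ s ∉ q, ∃ r, s * a = r * b) := by
  have key : ∀ a b : R, algebraMap R (Localization.AtPrime q) a ∣ algebraMap R _ b →
      ∃ s ∉ q, ∃ r, s * b = r * a := by
    rintro a b ⟨c, hc⟩
    obtain ⟨⟨r, s⟩, hrs⟩ := IsLocalization.surj q.primeCompl c
    have h1 : algebraMap R (Localization.AtPrime q) (s * b) = algebraMap R _ (r * a) := by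
      rw [map_mul, map_mul, hc, ← hrs]; ring
    obtain ⟨t, ht⟩ := (IsLocalization.eq_iff_exists q.primeCompl _).1 h1
    exact ⟨t * s, (t * s).2, t * r, by linear_combination ht⟩
  rcases (hP.2 q).2 (algebraMap R _ a) (algebraMap R _ b) with h | h
  · exact Or.inl (key _ _ h)
  · exact Or.inr (key _ _ h)

lemma prufer_min {R : Type*} [CommRing R] (hP : IsPrueferDomain R) (q : Ideal R) [q.IsPrime]
    {T : Type*} (z : T → R) (S : Finset T) (hS : S.Nonempty) :
    ∃ t₀ ∈ S, ∃ s ∉ q, ∀ t ∈ S, ∃ r, s * z t = r * z t₀ := by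
  classical
  induction hS using Finset.Nonempty.cons_induction with
  | singleton a =>
    exact ⟨a, by simp, 1, (Ideal.ne_top_iff_one q).1 (Ideal.IsPrime.ne_top inferInstance),
      by simpa using ⟨1, by simp⟩⟩
  | cons a S ha hS ih =>
    obtain ⟨t₀, ht₀, s, hs, h⟩ := ih
    rcases prufer_total hP q (z t₀) (z a) with ⟨s', hs', r', h'⟩ | ⟨s', hs', r', h'⟩
    · refine ⟨t₀, by simp [ht₀], s * s', fun hm => ?_, fun t ht => ?_⟩
      · rcases Ideal.IsPrime.mem_or_mem inferInstance hm with h | h <;> contradiction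
      · rcases Finset.mem_cons.1 ht with rfl | ht
        · exact ⟨s * r', by linear_combination s * h'⟩
        · obtain ⟨r, hr⟩ := h t ht
          exact ⟨s' * r, by linear_combination s' * hr⟩
    · refine ⟨a, by simp, s * s', fun hm => ?_, fun t ht => ?_⟩
      · rcases Ideal.IsPrime.mem_or_mem inferInstance hm with h | h <;> contradiction
      · rcases Finset.mem_cons.1 ht with rfl | ht
        · exact ⟨s * s', by ring⟩
        · obtain ⟨r, hr⟩ := h t ht
          exact ⟨r * r', by linear_combination s' * hr + r * h'⟩

open Classical in
lemma core_step {R : Type*} [CommRing R] (hP : IsPrueferDomain R) {T : Type*} [Fintype T]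
    [LinearOrder T] (N : Submodule R (T → R))
    (hN : ∀ a : R, a ≠ 0 → ∀ g : T → R, a • g ∈ N → g ∈ N)
    (q : Ideal R) [q.IsPrime] (L : Set T)
    (hL : ∀ g ∈ N, ∀ u, g u ∉ q → (∀ v, u < v → g v ∈ q) → u ∈ L)
    (b : L → T → R) (hb : ∀ u, b u ∈ N) (J : Ideal R)
    (hbJ : ∀ (u : L) (v : T), u.1 < v → b u v ∈ J)
    (y : T → R) (hy : y ∈ N) :
    ∃ δ : R, δ - ∏ u : L, b u u ∈ J ∧ δ • y ∈ Submodule.span R (Set.range b) := by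
  have := hP.1
  let B : Matrix L L R := Matrix.of fun u v => b u v
  have hdet : B.det - ∏ u : L, b u u ∈ J := by
    rw [← Ideal.Quotient.eq, RingHom.map_det, map_prod]
    rw [Matrix.det_of_isLowerTriangular]
    · rfl
    · intro u v huv
      have : u < v := by simpa using huv
      simpa [B] using (Ideal.Quotient.eq_zero_iff_mem.2 (hbJ u v this))
  refine ⟨B.det, hdet, ?_⟩
  let c : L → R := Matrix.vecMul (fun v : L => y v) B.adjugate
  have hcB : ∀ v : L, ∑ u, c u * b u v = B.det * y v := by
    intro v
    have : Matrix.vecMul c B = B.det • (fun v : L => y v) := by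
      simp only [c]
      rw [Matrix.vecMul_vecMul, Matrix.adjugate_mul, Matrix.vecMul_smul, Matrix.vecMul_one]
    have := congrFun this v
    simpa [Matrix.vecMul, dotProduct, B] using this
  set z : T → R := B.det • y - ∑ u, c u • b u with hz
  have hzN : z ∈ N := N.sub_mem (N.smul_mem _ hy) (N.sum_mem fun u _ => N.smul_mem _ (hb u))
  have hzL : ∀ v : L, z v = 0 := by
    intro v
    simp [hz, Finset.sum_apply, hcB]
  have hz0 : z = 0 := by
    by_contra hne
    obtain ⟨t₁, ht₁⟩ := Function.ne_iff.1 hne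
    obtain ⟨t₀, -, s, hs, h⟩ := prufer_min hP q z Finset.univ ⟨t₁, by simp⟩
    choose r hr using fun t => h t (by simp)
    have h0 : z t₀ ≠ 0 := by
      intro h0
      have := hr t₁
      rw [h0, mul_zero] at this
      rcases mul_eq_zero.1 this with h | h
      · exact hs (h ▸ q.zero_mem)
      · exact ht₁ h
    have hrN : r ∈ N := by
      apply hN (z t₀) h0
      have : z t₀ • r = s • z := by
        ext t; simp only [Pi.smul_apply, smul_eq_mul]; rw [hr t]; ring
      rw [this]; exact N.smul_mem _ hzN
    have hrt : r t₀ = s := by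
      have := hr t₀
      exact (mul_right_cancel₀ h0 this).symm
    obtain ⟨v, hv, hmax⟩ := (Finset.univ.filter fun t => r t ∉ q).exists_max_image id
      ⟨t₀, by simp [hrt, hs]⟩
    simp only [Finset.mem_filter, Finset.mem_univ, true_and, id] at hv hmax
    have hvL : v ∈ L := hL r hrN v hv fun w hw => by
      by_contra hc
      exact absurd (hmax w hc) (not_le.2 hw)
    have h1 := hr v
    rw [hzL ⟨v, hvL⟩, mul_zero] at h1
    rcases mul_eq_zero.1 h1.symm with h | h
    · exact hv (h ▸ q.zero_mem)
    · exact h0 h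
  have : B.det • y = ∑ u, c u • b u := sub_eq_zero.1 (hz ▸ hz0)
  rw [this]
  exact Submodule.sum_mem _ fun u _ => Submodule.smul_mem _ _ (Submodule.subset_span ⟨u, rfl⟩)

open Topology in
lemma constructible_compact {R : Type*} [CommRing R]
    (J : PrimeSpectrum R → Ideal R) (f : PrimeSpectrum R → R)
    (hfg : ∀ q, (J q).FG) (hJ : ∀ q, J q ≤ q.asIdeal) (hf : ∀ q, f q ∉ q.asIdeal) :
    ∃ F : Finset (PrimeSpectrum R), ∀ q' : PrimeSpectrum R, ∃ q ∈ F,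
      J q ≤ q'.asIdeal ∧ f q ∉ q'.asIdeal := by
  let X := WithConstructibleTopology (PrimeSpectrum R)
  let U : PrimeSpectrum R → Set X := fun q =>
    WithTopology.ofTopology ⁻¹' (PrimeSpectrum.zeroLocus (J q)) ∩
      WithTopology.ofTopology ⁻¹' (PrimeSpectrum.basicOpen (f q))
  have hU : ∀ q, IsOpen (U q) := by
    intro q
    refine IsOpen.inter ?_ ?_
    · refine WithConstructibleTopology.isOpen_iff.2 ?_
      apply IsCompact.isOpen_constructibleTopology_of_isClosed
      · obtain ⟨s, hs⟩ := hfg q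
        rw [← hs, PrimeSpectrum.zeroLocus_span]
        exact (PrimeSpectrum.isCompact_isOpen_iff.2 ⟨s, rfl⟩).1
      · exact PrimeSpectrum.isClosed_zeroLocus _
    · refine WithConstructibleTopology.isOpen_iff.2 ?_
      exact IsCompact.isOpen_constructibleTopology_of_isOpen
        (PrimeSpectrum.isCompact_basicOpen _) (PrimeSpectrum.isOpen_basicOpen)
  obtain ⟨F, hF⟩ := isCompact_univ.elim_finite_subcover U hU
    (fun x _ => Set.mem_iUnion.2 ⟨x.ofTopology, hJ _, hf _⟩)
  refine ⟨F, fun q' => ?_⟩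
  have := hF (Set.mem_univ (WithTopology.toTopology _ q'))
  simp only [Set.mem_iUnion] at this
  obtain ⟨q, hq, h1, h2⟩ := this
  exact ⟨q, hq, h1, h2⟩

section LocalStep

open MvPolynomial

lemma dickson {k m : ℕ} (S : Set ((Fin k →₀ ℕ) × Fin m)) :
    ∃ G : Finset ((Fin k →₀ ℕ) × Fin m), ↑G ⊆ S ∧ ∀ u ∈ S, ∃ t ∈ G, t.2 = u.2 ∧ t.1 ≤ u.1 := by
  classical
  have h : ∀ i : Fin m, ∃ G : Finset (Fin k →₀ ℕ), (∀ t ∈ G, (t, i) ∈ S) ∧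
      ∀ u, (u, i) ∈ S → ∃ t ∈ G, t ≤ u := by
    intro i
    let Si : Set (Fin k →₀ ℕ) := {u | (u, i) ∈ S}
    have hfin : {t | Minimal (· ∈ Si) t}.Finite :=
      WellQuasiOrderedLE.finite_of_isAntichain (setOfPred_minimal_antichain _)
    refine ⟨hfin.toFinset, fun t ht => ?_, fun u hu => ?_⟩
    · have : Minimal (· ∈ Si) t := by simpa using ht
      exact this.prop
    · obtain ⟨t, htu, ht⟩ := exists_minimal_le_of_wellFoundedLT (· ∈ Si) u hu
      exact ⟨t, by simpa using ht, htu⟩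
  choose G h1 h2 using h
  refine ⟨Finset.univ.biUnion fun i => (G i).map ⟨fun t => (t, i), fun a b h => by simpa using h⟩,
    ?_, ?_⟩
  · intro t ht
    simp only [Finset.coe_biUnion, Set.mem_iUnion, Finset.coe_map, Set.mem_image] at ht
    obtain ⟨i, -, a, ha, rfl⟩ := ht
    exact h1 i a ha
  · rintro ⟨u, i⟩ hu
    obtain ⟨t, ht, htu⟩ := h2 i u hu
    refine ⟨(t, i), ?_, rfl, htu⟩
    rw [Finset.mem_biUnion]
    exact ⟨i, Finset.mem_univ _, Finset.mem_map.2 ⟨t, ht, rfl⟩⟩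

/-- Monomials with position, of a fixed degree. -/
abbrev MonPos (k m d : ℕ) := {t : (Fin k →₀ ℕ) × Fin m // t.1.degree = d}

lemma finite_monPos (k m d : ℕ) : Finite (MonPos k m d) := by
  have h : Finite {t : Fin k →₀ ℕ // t.degree = d} := by
    have := Finsupp.finite_of_degree_le (σ := Fin k) d
    exact (this.subset (fun t ht => le_of_eq ht) : Set.Finite {t : Fin k →₀ ℕ | t.degree = d})
  exact Finite.of_injective
    (fun t : MonPos k m d => ((⟨t.1.1, t.2⟩, t.1.2) : {t : Fin k →₀ ℕ // t.degree = d} × Fin m))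
    (by rintro ⟨⟨a, b⟩, h⟩ ⟨⟨a', b'⟩, h'⟩ hh; simpa using hh)

/-- The comparison key on monomials with position. -/
noncomputable def monKey {k m : ℕ} (t : (Fin k →₀ ℕ) × Fin m) :
    Lex ((MonomialOrder.lex (σ := Fin k)).syn × Fin m) :=
  toLex ((MonomialOrder.lex (σ := Fin k)).toSyn t.1, t.2)

lemma monKey_injective {k m : ℕ} : Function.Injective (monKey (k := k) (m := m)) := by
  rintro ⟨a, i⟩ ⟨b, j⟩ h
  simpa [monKey] using h

lemma monKey_add {k m : ℕ} (w a b : Fin k →₀ ℕ) (i j : Fin m) :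
    monKey (w + a, i) < monKey (w + b, j) ↔ monKey (a, i) < monKey (b, j) := by
  simp [monKey, Prod.Lex.toLex_lt_toLex, map_add]

lemma monKey_add_lt {k m : ℕ} (w a b : Fin k →₀ ℕ) (i j : Fin m)
    (h : monKey (w + a, i) < monKey (b, j)) (hwb : w ≤ b) :
    monKey (a, i) < monKey (b - w, j) := by
  rw [← monKey_add w, add_tsub_cancel_of_le hwb]; exact h

variable {R : Type*} [CommRing R] {k m : ℕ}

/-- Reading off coefficients. -/
noncomputable def coeffsAt (d : ℕ) (y : Fin m → MvPolynomial (Fin k) R) : MonPos k m d → R :=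
  fun t => coeff t.1.1 (y t.1.2)

/-- The tuple of homogeneous polynomials with given coefficients. -/
noncomputable def ofCoeffs (d : ℕ) [Fintype (MonPos k m d)] :
    (MonPos k m d → R) →ₗ[R] (Fin m → MvPolynomial (Fin k) R) :=
  LinearMap.pi fun i => ∑ t : MonPos k m d,
    if t.1.2 = i then (monomial t.1.1).comp (LinearMap.proj t) else 0

lemma coeff_ofCoeffs (d : ℕ) [Fintype (MonPos k m d)] (c : MonPos k m d → R)
    (s : Fin k →₀ ℕ) (i : Fin m) :
    coeff s (ofCoeffs d c i) = if h : s.degree = d then c ⟨(s, i), h⟩ else 0 := by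
  classical
  simp only [ofCoeffs, LinearMap.pi_apply, LinearMap.sum_apply, coeff_sum]
  split_ifs with h
  · rw [Finset.sum_eq_single ⟨(s, i), h⟩]
    · simp
    · rintro ⟨⟨s', i'⟩, h'⟩ - hne
      by_cases hi : i' = i
      · subst hi
        have : s' ≠ s := by rintro rfl; exact hne rfl
        simp [coeff_monomial, this]
      · simp [hi]
    · simp
  · apply Finset.sum_eq_zero
    rintro ⟨⟨s', i'⟩, h'⟩ -
    have : s' ≠ s := by rintro rfl; exact h h'
    by_cases hi : i' = i <;> simp [hi, coeff_monomial, this]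

lemma ofCoeffs_coeffsAt (d : ℕ) [Fintype (MonPos k m d)] (y : Fin m → MvPolynomial (Fin k) R)
    (hy : ∀ i, (y i).IsHomogeneous d) : ofCoeffs d (coeffsAt d y) = y := by
  ext i s
  rw [coeff_ofCoeffs]
  split_ifs with h
  · rfl
  · by_contra hne
    exact h ((IsHomogeneous.coeff_eq_zero (hy i) (d := s) h ▸ hne) rfl).elim

lemma ofCoeffs_homogeneous (d : ℕ) [Fintype (MonPos k m d)] (c : MonPos k m d → R) (i : Fin m) :
    (ofCoeffs d c i).IsHomogeneous d := by
  intro s hs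
  rw [coeff_ofCoeffs] at hs
  by_contra h
  refine hs (dif_neg fun h' => h ?_)
  rw [← h', Finsupp.degree_eq_weight_one]; rfl

open Classical in
lemma local_step (hP : IsPrueferDomain R)
    (N : Submodule (MvPolynomial (Fin k) R) (Fin m → MvPolynomial (Fin k) R))
    (hN : ∀ r : R, r ≠ 0 → ∀ g : Fin m → MvPolynomial (Fin k) R, r • g ∈ N → g ∈ N)
    (q : Ideal R) [hq : q.IsPrime] :
    ∃ (J : Ideal R) (f : R)
      (N' : Submodule (MvPolynomial (Fin k) R) (Fin m → MvPolynomial (Fin k) R)),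
      J.FG ∧ J ≤ q ∧ f ∉ q ∧ N'.FG ∧ N' ≤ N ∧
      ∀ (d : ℕ) (y : Fin m → MvPolynomial (Fin k) R), y ∈ N → (∀ i, (y i).IsHomogeneous d) →
        ∀ q' : Ideal R, q'.IsPrime → J ≤ q' → f ∉ q' → ∃ δ ∉ q', δ • y ∈ N' := by
  let P : ((Fin k →₀ ℕ) × Fin m) → (Fin m → MvPolynomial (Fin k) R) → Prop := fun t g =>
    g ∈ N ∧ (∀ i, (g i).IsHomogeneous t.1.degree) ∧ coeff t.1 (g t.2) ∉ q ∧
      ∀ v : (Fin k →₀ ℕ) × Fin m, monKey t < monKey v → coeff v.1 (g v.2) ∈ q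
  obtain ⟨G, hGS, hG⟩ := dickson {t | ∃ g, P t g}
  choose! g hg using fun t (ht : t ∈ G) => hGS ht
  -- the finitely many coefficients which have to vanish
  let Jset : Set R := ⋃ t ∈ G, ⋃ i : Fin m,
    (fun s => coeff s (g t i)) '' {s | s ∈ (g t i).support ∧ monKey t < monKey (s, i)}
  have hJfin : Jset.Finite := by
    refine G.finite_toSet.biUnion fun t _ => Set.finite_iUnion fun i => Set.Finite.image _ ?_
    exact (g t i).support.finite_toSet.subset fun s hs => hs.1
  have hJmem : ∀ t ∈ G, ∀ v : (Fin k →₀ ℕ) × Fin m, monKey t < monKey v →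
      coeff v.1 (g t v.2) ∈ Ideal.span Jset := by
    intro t ht v hv
    by_cases h0 : coeff v.1 (g t v.2) = 0
    · rw [h0]; exact Ideal.zero_mem _
    · apply Ideal.subset_span
      simp only [Jset, Set.mem_iUnion]
      exact ⟨t, ht, v.2, v.1, ⟨by simpa using h0, hv⟩, rfl⟩
  refine ⟨Ideal.span Jset, ∏ t ∈ G, coeff t.1 (g t t.2), Submodule.span _ (g '' G),
    ⟨hJfin.toFinset, by simp⟩, ?_, ?_, ?_, ?_, ?_⟩
  · rw [Ideal.span_le]
    intro x hx
    simp only [Jset, Set.mem_iUnion] at hx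
    obtain ⟨t, ht, i, s, ⟨-, hs⟩, rfl⟩ := hx
    exact (hg t ht).2.2.2 (s, i) hs
  · rw [hq.prod_mem_iff]
    rintro ⟨t, ht, h⟩
    exact (hg t ht).2.2.1 h
  · exact Submodule.fg_span (G.finite_toSet.image _)
  · rw [Submodule.span_le]
    rintro _ ⟨t, ht, rfl⟩
    exact (hg t ht).1
  intro d y hy hyd q' hq' hJq' hfq'
  have := finite_monPos k m d
  have : Fintype (MonPos k m d) := Fintype.ofFinite _
  let _ : LinearOrder (MonPos k m d) :=
    LinearOrder.lift' (fun t => monKey t.1) (monKey_injective.comp Subtype.val_injective)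
  let L : Set (MonPos k m d) := {u | ∃ g, P u.1 g}
  choose τ hτG hτ2 hτ1 using fun u : L => hG u.1.1 u.2
  let β : L → (Fin m → MvPolynomial (Fin k) R) := fun u =>
    monomial (u.1.1.1 - (τ u).1) (1 : R) • g (τ u)
  have hβh : ∀ u i, (β u i).IsHomogeneous d := by
    intro u i
    have h1 := (hg _ (hτG u)).2.1 i
    have h2 : (monomial (u.1.1.1 - (τ u).1) (1 : R)).IsHomogeneous (u.1.1.1 - (τ u).1).degree :=
      isHomogeneous_monomial _ rfl
    have h3 := h2.mul h1
    rw [← map_add, tsub_add_cancel_of_le (hτ1 u), u.1.2] at h3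
    exact h3
  have hβc : ∀ u : L, ∀ v, u.1.1.1 - (τ u).1 ≤ v → ∀ i,
      coeff v (β u i) = coeff (v - (u.1.1.1 - (τ u).1)) (g (τ u) i) := by
    intro u v huv i
    simp [β, coeff_monomial_mul', huv]
  have hβc' : ∀ u : L, ∀ v, ¬ u.1.1.1 - (τ u).1 ≤ v → ∀ i, coeff v (β u i) = 0 := by
    intro u v huv i
    simp [β, coeff_monomial_mul', huv]
  have hβd : ∀ u : L, coeff u.1.1.1 (β u u.1.1.2) = coeff (τ u).1 (g (τ u) (τ u).2) := by
    intro u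
    rw [hβc _ _ tsub_le_self, tsub_tsub_cancel_of_le (hτ1 u), hτ2 u]
  obtain ⟨δ, hδ1, hδ2⟩ := core_step hP ((N.restrictScalars R).comap (ofCoeffs d))
    (fun a ha c hc => hN a ha _ (by simpa using hc)) q L
    (fun c hc u hu huv => ⟨ofCoeffs d c, hc, fun i => by
        rw [u.2]; exact ofCoeffs_homogeneous d c i, by
        rw [coeff_ofCoeffs, dif_pos u.2]; exact hu, fun v hv => by
        rw [coeff_ofCoeffs]
        split_ifs with h
        · exact huv ⟨v, h⟩ hv
        · exact q.zero_mem⟩)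
    (fun u => coeffsAt d (β u))
    (fun u => by
      change ofCoeffs d (coeffsAt d (β u)) ∈ N
      rw [ofCoeffs_coeffsAt d _ (hβh u)]
      exact N.smul_mem _ (hg _ (hτG u)).1)
    (Ideal.span Jset)
    (fun u v huv => by
      change coeff v.1.1 (β u v.1.2) ∈ _
      by_cases hle : u.1.1.1 - (τ u).1 ≤ v.1.1
      · rw [hβc _ _ hle]
        apply hJmem _ (hτG u) (v.1.1 - (u.1.1.1 - (τ u).1), v.1.2)
        apply monKey_add_lt _ _ _ _ _ _ hle
        rw [tsub_add_cancel_of_le (hτ1 u), hτ2 u]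
        exact huv
      · rw [hβc' _ _ hle]; exact Ideal.zero_mem _)
    (coeffsAt d y)
    (by
      change ofCoeffs d (coeffsAt d y) ∈ N
      rwa [ofCoeffs_coeffsAt d _ hyd])
  refine ⟨δ, fun hmem => ?_, ?_⟩
  · have h1 : ∏ u : L, coeffsAt d (β u) u.1 ∈ q' := by
      have := q'.sub_mem hmem (hJq' hδ1)
      simpa using this
    rw [hq'.prod_mem_iff] at h1
    obtain ⟨u, -, hu⟩ := h1
    apply hfq'
    rw [hq'.prod_mem_iff]
    refine ⟨τ u, hτG u, ?_⟩
    rw [← hβd u]; exact hu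
  · have h1 : Submodule.span R (Set.range fun u => coeffsAt d (β u)) ≤
        ((Submodule.span (MvPolynomial (Fin k) R) (g '' G)).restrictScalars R).comap
          (ofCoeffs d) := by
      rw [Submodule.span_le]
      rintro _ ⟨u, rfl⟩
      change ofCoeffs d (coeffsAt d (β u)) ∈ Submodule.span (MvPolynomial (Fin k) R) (g '' G)
      rw [ofCoeffs_coeffsAt d _ (hβh u)]
      exact Submodule.smul_mem _ _ (Submodule.subset_span ⟨_, hτG u, rfl⟩)
    have h2 : ofCoeffs d (δ • coeffsAt d y) ∈ Submodule.span (MvPolynomial (Fin k) R) (g '' G) :=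
      h1 hδ2
    rwa [map_smul, ofCoeffs_coeffsAt d _ hyd] at h2

end LocalStep

section Global

open MvPolynomial

variable {R : Type*} [CommRing R]

lemma global_step (hP : IsPrueferDomain R) {k m : ℕ}
    (N : Submodule (MvPolynomial (Fin k) R) (Fin m → MvPolynomial (Fin k) R))
    (hN : ∀ r : R, r ≠ 0 → ∀ g : Fin m → MvPolynomial (Fin k) R, r • g ∈ N → g ∈ N) :
    ∃ N' : Submodule (MvPolynomial (Fin k) R) (Fin m → MvPolynomial (Fin k) R),
      N'.FG ∧ N' ≤ N ∧ ∀ (d : ℕ) (y : Fin m → MvPolynomial (Fin k) R), y ∈ N →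
        (∀ i, (y i).IsHomogeneous d) → y ∈ N' := by
  choose J f N' h1 h2 h3 h4 h5 h6 using
    fun q : PrimeSpectrum R => local_step hP N hN q.asIdeal
  obtain ⟨F, hF⟩ := constructible_compact J f h1 h2 h3
  refine ⟨⨆ q ∈ F, N' q, Submodule.fg_biSup F _ fun q _ => h4 q, iSup₂_le fun q _ => h5 q,
    fun d y hy hyd => ?_⟩
  let I : Ideal R := Submodule.comap (LinearMap.toSpanSingleton R _ y)
    ((⨆ q ∈ F, N' q).restrictScalars R)
  have hI : I = ⊤ := by
    by_contra hne
    obtain ⟨M, hM, hIM⟩ := Ideal.exists_le_maximal I hne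
    obtain ⟨q, hq, hJ, hf⟩ := hF ⟨M, hM.isPrime⟩
    obtain ⟨δ, hδ, hδy⟩ := h6 q d y hy hyd M hM.isPrime hJ hf
    exact hδ (hIM (show δ • y ∈ _ from
      (le_iSup₂_of_le q hq le_rfl : N' q ≤ ⨆ q ∈ F, N' q) hδy))
  have h : (1 : R) • y ∈ ⨆ q ∈ F, N' q := (Ideal.eq_top_iff_one I).1 hI
  rwa [one_smul] at h

/-- Setting the first variable to one. -/
noncomputable def dehom (R : Type*) [CommRing R] (n : ℕ) :
    MvPolynomial (Fin (n + 1)) R →ₐ[R] MvPolynomial (Fin n) R :=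
  aeval (Fin.cons 1 X)

lemma exists_homogenization {n : ℕ} (p : MvPolynomial (Fin n) R) (d : ℕ) (hd : p.totalDegree ≤ d) :
    ∃ P : MvPolynomial (Fin (n + 1)) R, P.IsHomogeneous d ∧ dehom R n P = p := by
  have hren : ∀ a : MvPolynomial (Fin n) R, dehom R n (rename Fin.succ a) = a := by
    intro a
    rw [dehom, aeval_rename]
    have : (Fin.cons 1 X : Fin (n + 1) → MvPolynomial (Fin n) R) ∘ Fin.succ = X := by
      ext i; simp
    rw [this, aeval_X_left_apply]
  refine ⟨∑ s ∈ p.support, rename Fin.succ (monomial s (coeff s p)) * X 0 ^ (d - s.degree),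
    ?_, ?_⟩
  · apply IsHomogeneous.sum
    intro s hs
    have hsd : s.degree ≤ d := (le_totalDegree (p := p) hs).trans hd
    have h1 : (rename (Fin.succ : Fin n → Fin (n + 1)) (monomial s (coeff s p))).IsHomogeneous
        s.degree := (isHomogeneous_monomial _ rfl).rename_isHomogeneous
    have h2 := h1.mul ((isHomogeneous_X R (0 : Fin (n + 1))).pow (d - s.degree))
    have h3 : s.degree + 1 * (d - s.degree) = d := by omega
    rwa [h3] at h2
  · rw [map_sum]
    conv_rhs => rw [p.as_sum]
    refine Finset.sum_congr rfl fun s _ => ?_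
    rw [map_mul, map_pow, hren]
    simp [dehom]

theorem saturated_fg (hP : IsPrueferDomain R) {n m : ℕ}
    (N : Submodule (MvPolynomial (Fin n) R) (Fin m → MvPolynomial (Fin n) R))
    (hN : ∀ r : R, r ≠ 0 → ∀ g : Fin m → MvPolynomial (Fin n) R, r • g ∈ N → g ∈ N) :
    N.FG := by
  let φ := (dehom R n).toRingHom
  let Φ : (Fin m → MvPolynomial (Fin (n + 1)) R) →ₛₗ[φ] (Fin m → MvPolynomial (Fin n) R) :=
    { toFun := fun a i => dehom R n (a i)
      map_add' := fun a b => by ext1 i; simp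
      map_smul' := fun r a => by ext1 i; simp [φ] }
  have hφ : Function.Surjective φ := fun p =>
    let ⟨P, _, h⟩ := exists_homogenization p _ le_rfl; ⟨P, h⟩
  have : RingHomSurjective φ := ⟨hφ⟩
  obtain ⟨N', hfg, hle, hmem⟩ := global_step hP (N.comap Φ) (fun r hr g hg => by
    apply hN r hr
    have : Φ (r • g) = r • Φ g := by ext1 i; simp [Φ]
    rw [← this]; exact hg)
  have : N = N'.map Φ := by
    apply le_antisymm
    · intro a ha
      let d := Finset.univ.sup fun i => (a i).totalDegree
      choose P hP1 hP2 using fun i => exists_homogenization (a i) d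
        (Finset.le_sup (f := fun i => (a i).totalDegree) (Finset.mem_univ i))
      have hΦ : Φ P = a := funext hP2
      exact ⟨P, hmem d P (show Φ P ∈ N from hΦ ▸ ha) hP1, hΦ⟩
    · rw [Submodule.map_le_iff_le_comap]; exact hle
  rw [this]
  exact hfg.map Φ

end Global

theorem finitely_presented_algebra_over_prufer_coherent
    (R : Type*) [CommRing R] (hPrufer : IsPrueferDomain R)
    (A : Type*) [CommRing A] [Algebra R A]
    (hA : Algebra.FinitePresentation R A) :
    ∀ I : Ideal A, I.FG → Module.FinitePresentation A I := by
  intro I hI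
  have := hPrufer.1
  obtain ⟨n, π, hπ, hker⟩ := hA
  obtain ⟨r, g, hg⟩ := Submodule.fg_iff_exists_fin_generating_family.1 hker
  obtain ⟨m, f, hf⟩ := Submodule.fg_iff_exists_fin_generating_family.1 hI
  choose F hF using fun i => hπ (f i)
  let P := MvPolynomial (Fin n) R
  let w : Fin (m + r) → P := Fin.append F g
  -- the syzygies of the lifted generators together with the relations
  let K : Submodule P (Fin (m + r) → P) := LinearMap.ker (Fintype.linearCombination P w)
  have hK : K.FG := by
    apply saturated_fg hPrufer
    intro a ha c hc
    simp only [K, LinearMap.mem_ker] at hc ⊢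
    have h1 : a • Fintype.linearCombination P w c = 0 := by
      rw [← hc]; simp [Fintype.linearCombination_apply, Finset.smul_sum]
    exact (smul_eq_zero.1 h1).resolve_left ha
  let l0 : (Fin m → A) →ₗ[A] A := Fintype.linearCombination A f
  have hl0 : LinearMap.range l0 = I := by
    rw [Fintype.range_linearCombination]; exact hf
  let Φ : (Fin (m + r) → P) →ₛₗ[π.toRingHom] (Fin m → A) :=
    { toFun := fun a i => π (a (Fin.castAdd r i))
      map_add' := fun a b => by ext1 i; simp
      map_smul' := fun r a => by ext1 i; simp }
  have : RingHomSurjective π.toRingHom := ⟨hπ⟩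
  have hkerl : LinearMap.ker l0 = K.map Φ := by
    apply le_antisymm
    · intro a ha
      choose b hb using fun i => hπ (a i)
      have h1 : ∑ i, b i * F i ∈ RingHom.ker π := by
        rw [RingHom.mem_ker, map_sum]
        have h2 : ∑ i, a i * f i = 0 := by
          simpa [l0, Fintype.linearCombination_apply] using ha
        rw [← h2]
        exact Finset.sum_congr rfl fun i _ => by rw [map_mul, hb, hF]
      have h2 : ∑ i, b i * F i ∈ Submodule.span P (Set.range g) := by rw [hg]; exact h1
      obtain ⟨c, hc⟩ := (Submodule.mem_span_range_iff_exists_fun P).1 h2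
      refine ⟨Fin.append b (-c), ?_, ?_⟩
      · change Fintype.linearCombination P w _ = 0
        rw [Fintype.linearCombination_apply, Fin.sum_univ_add]
        simp only [w, Fin.append_left, Fin.append_right, Pi.neg_apply, neg_smul,
          Finset.sum_neg_distrib]
        rw [hc]; simp
      · ext1 i
        change π (Fin.append b (-c) (Fin.castAdd r i)) = a i
        rw [Fin.append_left, hb]
    · rw [Submodule.map_le_iff_le_comap]
      intro c hc
      change l0 (Φ c) = 0
      have h1 : Fintype.linearCombination P w c = 0 := hc
      rw [Fintype.linearCombination_apply, Fin.sum_univ_add] at h1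
      have h2 := congrArg π h1
      have hg0 : ∀ j, π (g j) = 0 := fun j => by
        have : g j ∈ RingHom.ker π := by
          have h : g j ∈ Submodule.span P (Set.range g) := Submodule.subset_span ⟨j, rfl⟩
          rw [hg] at h; exact h
        exact this
      simp only [w, Fin.append_left, Fin.append_right, smul_eq_mul, map_add, map_sum, map_mul,
        hg0, hF, mul_zero, Finset.sum_const_zero, add_zero, map_zero] at h2
      rw [Fintype.linearCombination_apply]
      exact h2
  have hfgker : (LinearMap.ker l0.rangeRestrict).FG := by
    rw [LinearMap.ker_rangeRestrict, hkerl]; exact hK.map Φ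
  have hfp : Module.FinitePresentation A (LinearMap.range l0) :=
    Module.finitePresentation_of_surjective l0.rangeRestrict l0.surjective_rangeRestrict hfgker
  rw [hl0] at hfp
  exact hfp
end
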